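/- arXiv:2104.08115 — 2 statements merged into one kernel-verified Lean document; each statement's English description precedes it below -/
import Mathlib

section
/- Let c>0, α∈(0,1) and R>0. There exists a constant C>0 such that for every f:ℝ²→ℝ of class C^{2,α}(Π) with support contained in B̂_R(0), the function K(f) is of class C^{2,α}(Π) and ‖K(f)‖_{C^{2,α}(Π)} ≤ C‖f‖_{C^{2,α}(Π)}. -/
open MeasureTheory Filter

noncomputable section

/-- The quantity `D(x, ŷ)` from the double layer potential kernels. -/
def Dden (x : ℝ × ℝ × ℝ) (y : ℝ × ℝ) : ℝ :=
  (x.1 ^ 2 + (x.2.1 - y.1) ^ 2) ^ 2 + 16 * (x.2.2 - y.2 + (1 / 2) * y.1 * x.1) ^ 2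

/-- The kernel `k₁(x, ŷ)`. -/
def k1 (c : ℝ) (x : ℝ × ℝ × ℝ) (y : ℝ × ℝ) : ℝ :=
  2 * c * (x.1 ^ 2 + (x.2.1 - y.1) ^ 2) * x.1 * Dden x y ^ (-(3 : ℝ) / 2)

/-- The kernel `k(x, ŷ)`. -/
def kker (c : ℝ) (x : ℝ × ℝ × ℝ) (y : ℝ × ℝ) : ℝ :=
  8 * c * (x.2.1 - y.1) * (x.2.2 - y.2 + (1 / 2) * y.1 * x.1) * Dden x y ^ (-(3 : ℝ) / 2)

/-- The homogeneous distance `d̃` on the vertical plane `Π ≅ ℝ²`. -/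
def dt (a b : ℝ × ℝ) : ℝ := ((a.1 - b.1) ^ 4 + 16 * (a.2 - b.2) ^ 2) ^ ((1 : ℝ) / 4)

/-- The ball of `d̃` of radius `r` centered at `a`. -/
def bhat (r : ℝ) (a : ℝ × ℝ) : Set (ℝ × ℝ) := {b | dt a b < r}

/-- The boundary convolution kernel `k(v̂) = 8c v₂ v₃ (v₂⁴ + 16 v₃²)^{-3/2}` on `Π`. -/
def kconv (c : ℝ) (v : ℝ × ℝ) : ℝ :=
  8 * c * v.1 * v.2 * (v.1 ^ 4 + 16 * v.2 ^ 2) ^ (-(3 : ℝ) / 2)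

/-- Partial derivative `∂₂` (in the first coordinate of the plane `Π ≅ ℝ²`,
which corresponds to `x₂`). -/
def d2 (f : ℝ × ℝ → ℝ) (p : ℝ × ℝ) : ℝ := deriv (fun s => f (s, p.2)) p.1

/-- Partial derivative `∂₃` (in the second coordinate of the plane `Π ≅ ℝ²`,
which corresponds to `x₃`). -/
def d3 (f : ℝ × ℝ → ℝ) (p : ℝ × ℝ) : ℝ := deriv (fun s => f (p.1, s)) p.2

/-- A function is bounded. -/
def Bdd (h : ℝ × ℝ → ℝ) : Prop := ∃ M, ∀ p, |h p| ≤ M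

/-- `f` is of class `C^{2,α}(Π)`: it is bounded, `∂₂f`, `∂₂²f`, `∂₃f` exist everywhere,
are continuous and bounded, and `[∂₂²f]_α`, `[∂₃f]_α` are finite. -/
def C2aClass (α : ℝ) (f : ℝ × ℝ → ℝ) : Prop :=
  Bdd f ∧
  (∀ p : ℝ × ℝ, DifferentiableAt ℝ (fun s => f (s, p.2)) p.1) ∧
  (∀ p : ℝ × ℝ, DifferentiableAt ℝ (fun s => d2 f (s, p.2)) p.1) ∧
  (∀ p : ℝ × ℝ, DifferentiableAt ℝ (fun s => f (p.1, s)) p.2) ∧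
  Continuous (d2 f) ∧ Continuous (d2 (d2 f)) ∧ Continuous (d3 f) ∧
  Bdd (d2 f) ∧ Bdd (d2 (d2 f)) ∧ Bdd (d3 f) ∧
  (∃ M, ∀ p q, |d2 (d2 f) p - d2 (d2 f) q| ≤ M * dt p q ^ α) ∧
  (∃ M, ∀ p q, |d3 f p - d3 f q| ≤ M * dt p q ^ α)

/-- Supremum of `|h|` over the plane. -/
def supAbs (h : ℝ × ℝ → ℝ) : ℝ := sSup {t | ∃ p, t = |h p|}

/-- Hölder seminorm `[h]_α` with respect to the homogeneous distance `d̃`. -/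
def holderSemi (α : ℝ) (h : ℝ × ℝ → ℝ) : ℝ :=
  sSup {t | ∃ p q, p ≠ q ∧ t = |h p - h q| / dt p q ^ α}

/-- The `C^{2,α}(Π)` norm. -/
def c2aNorm (α : ℝ) (h : ℝ × ℝ → ℝ) : ℝ :=
  supAbs h + supAbs (d2 h) + supAbs (d2 (d2 h)) + supAbs (d3 h) +
    holderSemi α (d2 (d2 h)) + holderSemi α (d3 h)

/-- The boundary singular integral operator `K`. -/
def Kop (c : ℝ) (g : ℝ × ℝ → ℝ) (x0 : ℝ × ℝ) : ℝ :=
  (∫ y in bhat 1 x0, kconv c (x0 - y) * (g y - g x0)) +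
    ∫ y in (bhat 1 x0)ᶜ, kconv c (x0 - y) * g y

/-! ### Auxiliary integrals -/

/-- The (unnormalised) Poisson kernel `y / (z² + y²)` of the half-plane. -/
def poissonKer (z y : ℝ) : ℝ := y / (z ^ 2 + y ^ 2)

lemma poissonKer_nonneg {y : ℝ} (hy : 0 ≤ y) (z : ℝ) : 0 ≤ poissonKer z y := by
  unfold poissonKer; positivity

lemma poissonKer_add_le {y : ℝ} (hy : 0 < y) (z : ℝ) {τ : ℝ} (hτ : |τ| ≤ y) :
    poissonKer (z + τ) y ≤ 3 * poissonKer z y := by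
  unfold poissonKer
  have h1 : τ ^ 2 ≤ y ^ 2 := sq_le_sq' (by linarith [neg_abs_le τ]) (by linarith [le_abs_self τ])
  rw [mul_div_assoc', div_le_div_iff₀ (by positivity) (by positivity)]
  nlinarith [mul_nonneg hy.le (sq_nonneg (z + 2 * τ)), mul_le_mul_of_nonneg_left h1 hy.le]

lemma integrable_poissonKer {y : ℝ} (hy : 0 < y) :
    Integrable (fun z => poissonKer z y) ∧ ∫ z, poissonKer z y = Real.pi := by
  have key : (fun z => poissonKer z y) = fun z => y⁻¹ * (1 + (y⁻¹ * z) ^ 2)⁻¹ := by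
    funext z
    unfold poissonKer
    have : 1 + (y⁻¹ * z) ^ 2 = (z ^ 2 + y ^ 2) / y ^ 2 := by field_simp; ring
    rw [this]
    field_simp
  rw [key]
  refine ⟨(integrable_inv_one_add_sq.comp_mul_left' (inv_pos.2 hy).ne').const_mul _, ?_⟩
  rw [integral_const_mul, Measure.integral_comp_mul_left (fun z => (1 + z ^ 2)⁻¹),
    integral_univ_inv_one_add_sq, inv_inv, abs_of_pos hy, smul_eq_mul]
  field_simp

lemma integrable_mul_poissonKer {G y : ℝ → ℝ} (hG : Integrable G) (hG0 : ∀ t, 0 ≤ G t)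
    (hy : Measurable y) (hy0 : ∀ t, t ≠ 0 → 0 < y t) :
    Integrable (fun v : ℝ × ℝ => G v.2 * poissonKer v.1 (y v.2)) ∧
      ∫ v : ℝ × ℝ, G v.2 * poissonKer v.1 (y v.2) = Real.pi * ∫ t, G t := by
  have hne : ∀ᵐ t : ℝ, t ≠ 0 := by
    simp [ae_iff]
  have hm : AEStronglyMeasurable (fun v : ℝ × ℝ => G v.2 * poissonKer v.1 (y v.2))
      ((volume : Measure ℝ).prod volume) := by
    refine (hG.aestronglyMeasurable.comp_snd).mul ?_
    unfold poissonKer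
    exact Measurable.aestronglyMeasurable (by fun_prop)
  have hin : ∀ᵐ t : ℝ, ∫ z, G t * poissonKer z (y t) = Real.pi * G t := by
    filter_upwards [hne] with t ht
    rw [integral_const_mul, (integrable_poissonKer (hy0 t ht)).2, mul_comm]
  have hprod : Integrable (fun v : ℝ × ℝ => G v.2 * poissonKer v.1 (y v.2))
      ((volume : Measure ℝ).prod volume) := by
    rw [integrable_prod_iff' hm]
    constructor
    · filter_upwards [hne] with t ht
      exact (integrable_poissonKer (hy0 t ht)).1.const_mul _
    · refine (hG.const_mul Real.pi).congr ?_
      filter_upwards [hin, hne] with t ht h0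
      rw [← ht]
      refine integral_congr_ae (Eventually.of_forall fun z => ?_)
      exact (Real.norm_of_nonneg (mul_nonneg (hG0 t) (poissonKer_nonneg (hy0 t h0).le z))).symm
  refine ⟨hprod, ?_⟩
  rw [Measure.volume_eq_prod, integral_prod_symm _ hprod, integral_congr_ae hin, integral_const_mul]

/-- The weight `min(|t|^{β-1}, r^γ |t|^{β-1-γ})`, split at `|t| = r`. -/
def splitWeight (β γ r t : ℝ) : ℝ :=
  if |t| ≤ r then |t| ^ (β - 1) else r ^ γ * |t| ^ (β - 1 - γ)

lemma splitWeight_nonneg {β γ r : ℝ} (hr : 0 < r) (t : ℝ) : 0 ≤ splitWeight β γ r t := by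
  unfold splitWeight; split_ifs <;> positivity

lemma integrable_splitWeight {β γ r : ℝ} (hβ : 0 < β) (hγ : β < γ) (hr : 0 < r) :
    Integrable (splitWeight β γ r) ∧
      ∫ t, splitWeight β γ r t = 2 * (1 / β + 1 / (γ - β)) * r ^ β := by
  set F : ℝ → ℝ := fun t => if t ≤ r then t ^ (β - 1) else r ^ γ * t ^ (β - 1 - γ) with hF
  have hcomp : splitWeight β γ r = fun t => F |t| := rfl
  have hE1 : Set.EqOn F (fun t => t ^ (β - 1)) (Set.Ioc 0 r) := fun t ht => if_pos ht.2
  have hE2 : Set.EqOn F (fun t => r ^ γ * t ^ (β - 1 - γ)) (Set.Ioi r) :=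
    fun t ht => if_neg (not_le.2 ht)
  have hI1 : IntegrableOn F (Set.Ioc 0 r) := by
    refine IntegrableOn.congr_fun ?_ hE1.symm measurableSet_Ioc
    exact (intervalIntegrable_iff_integrableOn_Ioc_of_le hr.le).1
      (intervalIntegral.intervalIntegrable_rpow' (by linarith))
  have hI2 : IntegrableOn F (Set.Ioi r) := by
    refine IntegrableOn.congr_fun ?_ hE2.symm measurableSet_Ioi
    exact (integrableOn_Ioi_rpow_of_lt (by linarith) hr).const_mul _
  have hval : ∫ t, F |t| = 2 * (1 / β + 1 / (γ - β)) * r ^ β := by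
    rw [integral_comp_abs, ← Set.Ioc_union_Ioi_eq_Ioi hr.le,
      setIntegral_union (Set.Ioc_disjoint_Ioi le_rfl) measurableSet_Ioi hI1 hI2,
      setIntegral_congr_fun measurableSet_Ioc hE1, setIntegral_congr_fun measurableSet_Ioi hE2,
      ← intervalIntegral.integral_of_le hr.le, integral_rpow (Or.inl (by linarith)),
      integral_const_mul, integral_Ioi_rpow_of_lt (by linarith) hr]
    have h1 : r ^ γ * r ^ (β - 1 - γ + 1) = r ^ β := by
      rw [← Real.rpow_add hr]; congr 1; ring
    have h2 : β - 1 + 1 = β := by ring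
    have h3 : β - 1 - γ + 1 = -(γ - β) := by ring
    rw [h2, Real.zero_rpow hβ.ne', ← mul_div_assoc, mul_neg, h1, h3, neg_div_neg_eq]
    ring
  rw [hcomp]
  refine ⟨?_, hval⟩
  by_contra h
  have h0 := integral_undef h
  rw [hval] at h0
  have : 0 < 1 / (γ - β) := by have := sub_pos.2 hγ; positivity
  have : 0 < 2 * (1 / β + 1 / (γ - β)) * r ^ β := by positivity
  linarith

/-! ### Odd kernels acting on compactly supported Hölder functions -/

/-- The reflection `(z, t) ↦ (z, -t)`. -/
def reflSnd (v : ℝ × ℝ) : ℝ × ℝ := (v.1, -v.2)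

lemma measurePreserving_reflSnd : MeasurePreserving reflSnd :=
  (MeasurePreserving.id volume).prod (Measure.measurePreserving_neg volume)

lemma measurableEmbedding_reflSnd : MeasurableEmbedding reflSnd :=
  ((MeasurableEquiv.refl ℝ).prodCongr (MeasurableEquiv.neg ℝ)).measurableEmbedding

lemma measurable_reflSnd : Measurable reflSnd := measurePreserving_reflSnd.measurable

/-- A kernel odd in the second variable `t`, with size and smoothness in the first variable `z`
governed by the Poisson kernel at height `|t|^γ`. -/
structure IsOddKernel (A γ : ℝ) (κ : ℝ × ℝ → ℝ) : Prop where
  measurable : Measurable κ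
  odd : ∀ z t, κ (z, -t) = -κ (z, t)
  bound : ∀ z t, t ≠ 0 → |κ (z, t)| ≤ A * (|t|⁻¹ * poissonKer z (|t| ^ γ))
  deriv : ∀ z t, t ≠ 0 → ∃ d, HasDerivAt (fun z => κ (z, t)) d z ∧
    |d| ≤ A * (|t|⁻¹ * (|t| ^ γ)⁻¹ * poissonKer z (|t| ^ γ))
  far : ∀ z t, 1 ≤ |t| → |κ (z, t)| ≤ A

/-- Functions supported in the box `[-L, L]²`, bounded by `M` and separately Hölder continuous
with exponents `β₁`, `β₂` and constant `M`. -/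
structure IsHolderSupp (β₁ β₂ L M : ℝ) (g : ℝ × ℝ → ℝ) : Prop where
  bound : ∀ p, |g p| ≤ M
  holder₁ : ∀ a a' b, |g (a, b) - g (a', b)| ≤ M * |a - a'| ^ β₁
  holder₂ : ∀ a b b', |g (a, b) - g (a, b')| ≤ M * |b - b'| ^ β₂
  supp : ∀ p, g p ≠ 0 → |p.1| ≤ L ∧ |p.2| ≤ L

/-- The operator with kernel `κ`, symmetrised in the second variable. -/
def symOp (κ g : ℝ × ℝ → ℝ) (x : ℝ × ℝ) : ℝ := ∫ v, κ v * (g (x - v) - g (x - reflSnd v))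

/-- The indicator function of the box `[-L, L]²`. -/
def boxInd (L : ℝ) : ℝ × ℝ → ℝ := (Set.Icc (-L) L ×ˢ Set.Icc (-L) L).indicator 1

lemma boxInd_nonneg (L : ℝ) (p : ℝ × ℝ) : 0 ≤ boxInd L p :=
  Set.indicator_nonneg (fun _ _ => zero_le_one) p

lemma boxInd_eq_one {L : ℝ} {p : ℝ × ℝ} (h1 : |p.1| ≤ L) (h2 : |p.2| ≤ L) : boxInd L p = 1 :=
  Set.indicator_of_mem (show p ∈ Set.Icc (-L) L ×ˢ Set.Icc (-L) L from
    ⟨abs_le.1 h1, abs_le.1 h2⟩) _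

lemma integrable_boxInd (L : ℝ) : Integrable (boxInd L) := by
  refine (integrable_indicator_iff (measurableSet_Icc.prod measurableSet_Icc)).2 ?_
  exact integrableOn_const (isCompact_Icc.prod isCompact_Icc).measure_lt_top.ne

section

variable {A β β' γ L M : ℝ} {κ g : ℝ × ℝ → ℝ}

lemma continuous_of_separately_holder {β₁ β₂ : ℝ} (h1 : 0 < β₁) (h2 : 0 < β₂)
    (hg1 : ∀ a a' b, |g (a, b) - g (a', b)| ≤ M * |a - a'| ^ β₁)
    (hg2 : ∀ a b b', |g (a, b) - g (a, b')| ≤ M * |b - b'| ^ β₂) : Continuous g := by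
  rw [continuous_iff_continuousAt]
  rintro ⟨a, b⟩
  rw [ContinuousAt, tendsto_iff_norm_sub_tendsto_zero]
  have hlim : Tendsto (fun p : ℝ × ℝ => M * |p.1 - a| ^ β₁ + M * |p.2 - b| ^ β₂) (nhds (a, b))
      (nhds 0) := by
    have hc : Continuous fun p : ℝ × ℝ => M * |p.1 - a| ^ β₁ + M * |p.2 - b| ^ β₂ := by
      refine (continuous_const.mul (Continuous.rpow_const (by fun_prop) fun _ => Or.inr h1.le)).add
        (continuous_const.mul (Continuous.rpow_const (by fun_prop) fun _ => Or.inr h2.le))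
    have := hc.tendsto (a, b)
    simpa [Real.zero_rpow h1.ne', Real.zero_rpow h2.ne'] using this
  refine squeeze_zero (fun _ => norm_nonneg _) ?_ hlim
  rintro ⟨a', b'⟩
  calc |g (a', b') - g (a, b)| ≤ |g (a', b') - g (a, b')| + |g (a, b') - g (a, b)| :=
        abs_sub_le _ _ _
    _ ≤ _ := add_le_add (hg1 _ _ _) (hg2 _ _ _)

lemma IsHolderSupp.nonneg {β₁ β₂ : ℝ} (hg : IsHolderSupp β₁ β₂ L M g) : 0 ≤ M :=
  (abs_nonneg _).trans (hg.bound 0)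

lemma IsHolderSupp.continuous {β₁ β₂ : ℝ} (h1 : 0 < β₁) (h2 : 0 < β₂)
    (hg : IsHolderSupp β₁ β₂ L M g) : Continuous g :=
  continuous_of_separately_holder h1 h2 hg.holder₁ hg.holder₂

lemma IsHolderSupp.swap {β₁ β₂ : ℝ} (hg : IsHolderSupp β₁ β₂ L M g) :
    IsHolderSupp β₂ β₁ L M (g ∘ Prod.swap) :=
  ⟨fun _ => hg.bound _, fun a a' b => hg.holder₂ b a a', fun a b b' => hg.holder₁ b b' a,
    fun _ hp => (hg.supp _ hp).symm⟩

lemma IsHolderSupp.abs_le_boxInd {β₁ β₂ : ℝ} (hg : IsHolderSupp β₁ β₂ L M g) {L' : ℝ}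
    {p q : ℝ × ℝ} (h1 : |p.1 - q.1| + L ≤ L') (h2 : |p.2 - q.2| + L ≤ L') :
    |g q| ≤ M * boxInd L' p := by
  by_cases h : g q = 0
  · rw [h, abs_zero]; exact mul_nonneg hg.nonneg (boxInd_nonneg _ _)
  · obtain ⟨h3, h4⟩ := hg.supp q h
    rw [boxInd_eq_one, mul_one]
    · exact hg.bound q
    · have := abs_add_le (p.1 - q.1) q.1
      rw [sub_add_cancel] at this; linarith
    · have := abs_add_le (p.2 - q.2) q.2
      rw [sub_add_cancel] at this; linarith

lemma IsHolderSupp.refl_diff_le (hβ1 : β ≤ 1) (hg : IsHolderSupp β' β L M g)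
    (x v : ℝ × ℝ) : |g (x - v) - g (x - reflSnd v)| ≤ 2 * M * |v.2| ^ β := by
  have h := hg.holder₂ (x.1 - v.1) (x.2 - v.2) (x.2 - -v.2)
  have e : x.2 - v.2 - (x.2 - -v.2) = -(2 * v.2) := by ring
  rw [e, abs_neg, abs_mul, abs_two, Real.mul_rpow zero_le_two (abs_nonneg _)] at h
  refine h.trans ?_
  have h2 : (2 : ℝ) ^ β ≤ 2 := by
    simpa using Real.rpow_le_rpow_of_exponent_le one_le_two hβ1
  have := mul_le_mul_of_nonneg_left
    (mul_le_mul_of_nonneg_right h2 (Real.rpow_nonneg (abs_nonneg v.2) β)) hg.nonneg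
  linarith

lemma IsOddKernel.apply_zero (hκ : IsOddKernel A γ κ) (z : ℝ) : κ (z, 0) = 0 := by
  have := hκ.odd z 0
  rw [neg_zero] at this; linarith

/-- An integrable majorant for the integrand of `symOp`. -/
def symMajorant (A β γ L M : ℝ) (x v : ℝ × ℝ) : ℝ :=
  A * M * (2 * (splitWeight β γ 1 v.2 * poissonKer v.1 (|v.2| ^ γ)) +
    (boxInd L (x - v) + boxInd L (x - reflSnd v)))

lemma integrable_symMajorant (A L M : ℝ) (hβ : 0 < β) (hγ : β < γ) (x : ℝ × ℝ) :
    Integrable (symMajorant A β γ L M x) ∧ ∫ v, symMajorant A β γ L M x v =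
      A * M * (4 * Real.pi * (1 / β + 1 / (γ - β)) + 2 * ∫ v, boxInd L v) := by
  obtain ⟨h1, h1'⟩ := integrable_splitWeight hβ hγ one_pos
  obtain ⟨h2, h2'⟩ := integrable_mul_poissonKer (y := fun t => |t| ^ γ) h1
    (fun t => splitWeight_nonneg one_pos t) (by fun_prop)
    (fun t ht => Real.rpow_pos_of_pos (abs_pos.2 ht) _)
  have h3 : Integrable fun v => boxInd L (x - v) := (integrable_boxInd L).comp_sub_left x
  have h4 : Integrable fun v => boxInd L (x - reflSnd v) :=
    (measurePreserving_reflSnd.integrable_comp_emb measurableEmbedding_reflSnd).2 h3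
  have e3 : ∫ v, boxInd L (x - v) = ∫ v, boxInd L v := integral_sub_left_eq_self _ _ _
  have e4 : ∫ v, boxInd L (x - reflSnd v) = ∫ v, boxInd L v := by
    rw [← e3]
    exact measurePreserving_reflSnd.integral_comp measurableEmbedding_reflSnd
      (fun v => boxInd L (x - v))
  refine ⟨((h2.const_mul 2).add (h3.add h4)).const_mul _, ?_⟩
  unfold symMajorant
  have h5 : Integrable fun v => boxInd L (x - v) + boxInd L (x - reflSnd v) := h3.add h4
  rw [integral_const_mul, integral_add (h2.const_mul 2) h5, integral_const_mul, h2', h1',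
    integral_add h3 h4, e3, e4, Real.one_rpow]
  ring

lemma IsOddKernel.abs_mul_le (hκ : IsOddKernel A γ κ) (hA : 0 ≤ A)
    (hβ1 : β ≤ 1) (hg : IsHolderSupp β' β L M g) {x x' : ℝ × ℝ} {L' : ℝ}
    (h1 : |x.1 - x'.1| + L ≤ L') (h2 : |x.2 - x'.2| + L ≤ L') (v : ℝ × ℝ) :
    |κ v * (g (x' - v) - g (x' - reflSnd v))| ≤ symMajorant A β γ L' M x v := by
  have hM := hg.nonneg
  have hS := splitWeight_nonneg (β := β) (γ := γ) one_pos v.2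
  have hP := poissonKer_nonneg (Real.rpow_nonneg (abs_nonneg v.2) γ) v.1
  have hb1 := boxInd_nonneg L' (x - v)
  have hb2 := boxInd_nonneg L' (x - reflSnd v)
  rw [abs_mul]
  unfold symMajorant
  rcases eq_or_ne v.2 0 with h0 | h0
  · have : κ v = 0 := by
      have e : v = (v.1, 0) := Prod.ext rfl h0
      rw [e]
      exact hκ.apply_zero v.1
    rw [this, abs_zero, zero_mul]
    positivity
  rcases le_or_gt |v.2| 1 with ht | ht
  · have hd := hg.refl_diff_le hβ1 x' v
    calc |κ v| * |g (x' - v) - g (x' - reflSnd v)|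
        ≤ (A * (|v.2|⁻¹ * poissonKer v.1 (|v.2| ^ γ))) * (2 * M * |v.2| ^ β) :=
          mul_le_mul (hκ.bound v.1 v.2 h0) hd (abs_nonneg _) (by positivity)
      _ = A * M * (2 * (splitWeight β γ 1 v.2 * poissonKer v.1 (|v.2| ^ γ))) := by
          rw [splitWeight, if_pos ht, Real.rpow_sub_one (abs_pos.2 h0).ne', div_eq_mul_inv]
          ring
      _ ≤ _ := by
          apply mul_le_mul_of_nonneg_left _ (by positivity)
          linarith
  · have g1 : |g (x' - v)| ≤ M * boxInd L' (x - v) :=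
      hg.abs_le_boxInd (by simpa using h1) (by simpa using h2)
    have g2 : |g (x' - reflSnd v)| ≤ M * boxInd L' (x - reflSnd v) :=
      hg.abs_le_boxInd (by simpa using h1) (by simpa using h2)
    calc |κ v| * |g (x' - v) - g (x' - reflSnd v)|
        ≤ A * (M * boxInd L' (x - v) + M * boxInd L' (x - reflSnd v)) :=
          mul_le_mul (hκ.far v.1 v.2 ht.le) ((abs_sub _ _).trans (add_le_add g1 g2))
            (abs_nonneg _) hA
      _ = A * M * (boxInd L' (x - v) + boxInd L' (x - reflSnd v)) := by ring
      _ ≤ _ := by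
          apply mul_le_mul_of_nonneg_left _ (by positivity)
          have := mul_nonneg hS hP
          linarith

lemma IsOddKernel.aestronglyMeasurable (hκ : IsOddKernel A γ κ) (hg : Continuous g)
    (x : ℝ × ℝ) :
    AEStronglyMeasurable fun v => κ v * (g (x - v) - g (x - reflSnd v)) := by
  refine Measurable.aestronglyMeasurable (hκ.measurable.mul (Measurable.sub ?_ ?_))
  · exact hg.measurable.comp (measurable_const.sub measurable_id)
  · exact hg.measurable.comp (measurable_const.sub measurable_reflSnd)

lemma IsOddKernel.integrable (hκ : IsOddKernel A γ κ) (hA : 0 ≤ A) (hβ : 0 < β) (hβ' : 0 < β')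
    (hγ : β < γ) (hβ1 : β ≤ 1) (hg : IsHolderSupp β' β L M g) (x : ℝ × ℝ) :
    Integrable fun v => κ v * (g (x - v) - g (x - reflSnd v)) :=
  (integrable_symMajorant A L M hβ hγ x).1.mono' (hκ.aestronglyMeasurable (hg.continuous hβ' hβ) x)
    (Eventually.of_forall fun v =>
      hκ.abs_mul_le (x := x) (x' := x) (L' := L) hA hβ1 hg (by simp) (by simp) v)

lemma IsOddKernel.abs_symOp_le (hκ : IsOddKernel A γ κ) (hA : 0 ≤ A) (hβ : 0 < β)
    (hγ : β < γ) (hβ1 : β ≤ 1) (hg : IsHolderSupp β' β L M g) (x : ℝ × ℝ) :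
    |symOp κ g x| ≤
      A * M * (4 * Real.pi * (1 / β + 1 / (γ - β)) + 2 * ∫ v, boxInd L v) := by
  obtain ⟨h1, h2⟩ := integrable_symMajorant A L M hβ hγ x
  rw [← h2, ← Real.norm_eq_abs, symOp]
  exact norm_integral_le_of_norm_le h1
    (Eventually.of_forall fun v =>
      hκ.abs_mul_le (x := x) (x' := x) (L' := L) hA hβ1 hg (by simp) (by simp) v)

lemma IsOddKernel.hasDerivAt_symOp (hκ : IsOddKernel A γ κ) (hA : 0 ≤ A) (hβ : 0 < β)
    (hβ' : 0 < β') (hγ : β < γ) (hβ1 : β ≤ 1) (hg : IsHolderSupp β' β L M g) {g' : ℝ × ℝ → ℝ}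
    (hg' : IsHolderSupp β' β L M g') {e : ℝ × ℝ} (he1 : |e.1| ≤ 1) (he2 : |e.2| ≤ 1)
    (hd : ∀ p s, HasDerivAt (fun s : ℝ => g (p + s • e)) (g' (p + s • e)) s)
    (x : ℝ × ℝ) (s₀ : ℝ) :
    HasDerivAt (fun s : ℝ => symOp κ g (x + s • e)) (symOp κ g' (x + s₀ • e)) s₀ := by
  refine (hasDerivAt_integral_of_dominated_loc_of_deriv_le
    (F := fun (s : ℝ) v => κ v * (g (x + s • e - v) - g (x + s • e - reflSnd v)))
    (F' := fun (s : ℝ) v => κ v * (g' (x + s • e - v) - g' (x + s • e - reflSnd v)))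
    (bound := symMajorant A β γ (1 + L) M (x + s₀ • e))
    (Metric.ball_mem_nhds s₀ one_pos) ?_ ?_ ?_ ?_ ?_ ?_).2
  · exact Eventually.of_forall fun s => hκ.aestronglyMeasurable (hg.continuous hβ' hβ) _
  · exact hκ.integrable hA hβ hβ' hγ hβ1 hg _
  · exact hκ.aestronglyMeasurable (hg'.continuous hβ' hβ) _
  · refine Eventually.of_forall fun v s hs => ?_
    rw [Metric.mem_ball, Real.dist_eq, abs_sub_comm] at hs
    refine hκ.abs_mul_le hA hβ1 hg' ?_ ?_ v
    · have : (x + s₀ • e).1 - (x + s • e).1 = (s₀ - s) * e.1 := by simp; ring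
      rw [this, abs_mul]
      have := mul_le_one₀ hs.le (abs_nonneg e.1) he1
      linarith
    · have : (x + s₀ • e).2 - (x + s • e).2 = (s₀ - s) * e.2 := by simp; ring
      rw [this, abs_mul]
      have := mul_le_one₀ hs.le (abs_nonneg e.2) he2
      linarith
  · exact (integrable_symMajorant A _ M hβ hγ _).1
  · refine Eventually.of_forall fun v s _ => ?_
    have key : ∀ w : ℝ × ℝ,
        HasDerivAt (fun s : ℝ => g (x + s • e - w)) (g' (x + s • e - w)) s := by
      intro w
      have := hd (x - w) s
      simpa only [sub_add_eq_add_sub] using this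
    exact ((key v).sub (key (reflSnd v))).const_mul (κ v)

lemma IsOddKernel.abs_sub_le (hκ : IsOddKernel A γ κ) {z h t : ℝ} (ht : t ≠ 0)
    (hh : |h| ≤ |t| ^ γ) :
    |κ (z + h, t) - κ (z, t)| ≤
      3 * A * |h| * (|t|⁻¹ * (|t| ^ γ)⁻¹ * poissonKer z (|t| ^ γ)) := by
  have hy : 0 < |t| ^ γ := Real.rpow_pos_of_pos (abs_pos.2 ht) _
  have hP := poissonKer_nonneg hy.le z
  have hp : 0 < |t| := abs_pos.2 ht
  choose d hd hb using fun z => hκ.deriv z t ht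
  have hA : 0 ≤ A * (|t|⁻¹ * (|t| ^ γ)⁻¹) := by
    have h1 := (abs_nonneg _).trans (hb 0)
    have hP0 : 0 < poissonKer 0 (|t| ^ γ) := by unfold poissonKer; positivity
    rw [← mul_assoc] at h1
    exact nonneg_of_mul_nonneg_left h1 hP0
  have := (convex_uIcc z (z + h)).norm_image_sub_le_of_norm_hasDerivWithin_le
    (f := fun z => κ (z, t)) (f' := d)
    (C := 3 * A * (|t|⁻¹ * (|t| ^ γ)⁻¹ * poissonKer z (|t| ^ γ)))
    (fun w _ => (hd w).hasDerivWithinAt) ?_ Set.left_mem_uIcc Set.right_mem_uIcc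
  · rw [add_sub_cancel_left, Real.norm_eq_abs, Real.norm_eq_abs] at this
    linarith
  · intro w hw
    have hw' : |w - z| ≤ |t| ^ γ := by
      have := Set.abs_sub_left_of_mem_uIcc hw
      rw [add_sub_cancel_left] at this
      exact this.trans hh
    have h3 := poissonKer_add_le hy z hw'
    rw [add_sub_cancel] at h3
    refine (hb w).trans ?_
    have := mul_le_mul_of_nonneg_left h3 hA
    linarith

lemma IsOddKernel.holder_symOp (hκ : IsOddKernel A γ κ) (hA : 0 ≤ A) (hβ : 0 < β) (hβ' : 0 < β')
    (hγ : β < γ) (hβ1 : β ≤ 1) (hg : IsHolderSupp β' β L M g) (a a' b : ℝ) :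
    |symOp κ g (a, b) - symOp κ g (a', b)| ≤
      A * M * (24 * Real.pi * (1 / β + 1 / (γ - β))) * |a - a'| ^ (β / γ) := by
  have hγ0 : 0 < γ := hβ.trans hγ
  have hM := hg.nonneg
  rcases eq_or_ne a a' with rfl | hne
  · have : 0 < β / γ := by positivity
    simp [Real.zero_rpow this.ne']
  set h := a - a' with hh
  have hpos : 0 < |h| := abs_pos.2 (sub_ne_zero.2 hne)
  set r := |h| ^ (1 / γ) with hr
  have hr0 : 0 < r := Real.rpow_pos_of_pos hpos _
  have hrγ : r ^ γ = |h| := by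
    rw [hr, ← Real.rpow_mul hpos.le, one_div_mul_cancel hγ0.ne', Real.rpow_one]
  have hrβ : r ^ β = |h| ^ (β / γ) := by
    rw [hr, ← Real.rpow_mul hpos.le]; congr 1; ring
  obtain ⟨h1, h1'⟩ := integrable_splitWeight hβ hγ hr0
  obtain ⟨h2, h2'⟩ := integrable_mul_poissonKer (y := fun t => |t| ^ γ) h1
    (fun t => splitWeight_nonneg hr0 t) (by fun_prop)
    (fun t ht => Real.rpow_pos_of_pos (abs_pos.2 ht) _)
  set Φ : ℝ × ℝ → ℝ := fun v => splitWeight β γ r v.2 * poissonKer v.1 (|v.2| ^ γ) with hΦ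
  have h3 : Integrable fun v => Φ (v + (h, 0)) := h2.comp_add_right _
  have h3' : ∫ v, Φ (v + (h, 0)) = ∫ v, Φ v := integral_add_right_eq_self Φ (h, 0)
  have hshift : symOp κ g (a, b) =
      ∫ v, κ (v + (h, 0)) * (g ((a', b) - v) - g ((a', b) - reflSnd v)) := by
    rw [symOp, ← integral_add_right_eq_self
      (fun v => κ v * (g ((a, b) - v) - g ((a, b) - reflSnd v))) ((h, 0) : ℝ × ℝ)]
    refine integral_congr_ae (Eventually.of_forall fun v => ?_)
    have e1 : ((a, b) : ℝ × ℝ) - (v + (h, 0)) = (a', b) - v := by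
      ext <;> simp [hh]; ring
    have e2 : ((a, b) : ℝ × ℝ) - reflSnd (v + (h, 0)) = (a', b) - reflSnd v := by
      ext <;> simp [hh, reflSnd]; ring
    simp only [e1, e2]
  have hint1 : Integrable fun v => κ (v + (h, 0)) * (g ((a', b) - v) - g ((a', b) - reflSnd v)) := by
    have := (hκ.integrable hA hβ hβ' hγ hβ1 hg (a, b)).comp_add_right ((h, 0) : ℝ × ℝ)
    refine this.congr (Eventually.of_forall fun v => ?_)
    have e1 : ((a, b) : ℝ × ℝ) - (v + (h, 0)) = (a', b) - v := by
      ext <;> simp [hh]; ring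
    have e2 : ((a, b) : ℝ × ℝ) - reflSnd (v + (h, 0)) = (a', b) - reflSnd v := by
      ext <;> simp [hh, reflSnd]; ring
    simp only [e1, e2]
  rw [hshift, symOp, ← integral_sub hint1 (hκ.integrable hA hβ hβ' hγ hβ1 hg (a', b))]
  have hmaj : Integrable fun v => 6 * A * M * (Φ (v + (h, 0)) + Φ v) := (h3.add h2).const_mul _
  have hval : ∫ v, 6 * A * M * (Φ (v + (h, 0)) + Φ v) =
      A * M * (24 * Real.pi * (1 / β + 1 / (γ - β))) * |h| ^ (β / γ) := by
    rw [integral_const_mul, integral_add h3 h2, h3', h2', h1', hrβ]; ring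
  rw [← hval, ← Real.norm_eq_abs]
  refine norm_integral_le_of_norm_le hmaj (Eventually.of_forall ?_)
  rintro ⟨z, t⟩
  rw [← sub_mul, Real.norm_eq_abs, abs_mul]
  have hd := hg.refl_diff_le hβ1 (a', b) (z, t)
  have hS := splitWeight_nonneg (β := β) (γ := γ) hr0 t
  have hy := Real.rpow_nonneg (abs_nonneg t) γ
  have hP1 := poissonKer_nonneg hy z
  have hP2 := poissonKer_nonneg hy (z + h)
  simp only [hΦ, Prod.mk_add_mk, add_zero] at hd ⊢
  rcases eq_or_ne t 0 with rfl | h0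
  · rw [hκ.apply_zero, hκ.apply_zero, sub_zero, abs_zero, zero_mul]
    rw [abs_zero] at hP1 hP2
    exact mul_nonneg (by positivity) (add_nonneg (mul_nonneg hS hP2) (mul_nonneg hS hP1))
  have htp := abs_pos.2 h0
  rcases le_or_gt |t| r with ht | ht
  · calc _ ≤ (A * (|t|⁻¹ * poissonKer (z + h) (|t| ^ γ)) + A * (|t|⁻¹ * poissonKer z (|t| ^ γ))) *
          (2 * M * |t| ^ β) :=
          mul_le_mul ((abs_sub _ _).trans (add_le_add (hκ.bound _ _ h0) (hκ.bound _ _ h0))) hd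
            (abs_nonneg _) (by positivity)
      _ = 2 * A * M * (splitWeight β γ r t * poissonKer (z + h) (|t| ^ γ) +
          splitWeight β γ r t * poissonKer z (|t| ^ γ)) := by
          rw [splitWeight, if_pos ht, Real.rpow_sub_one htp.ne', div_eq_mul_inv]
          ring
      _ ≤ _ := by
          apply mul_le_mul_of_nonneg_right _ (by positivity)
          have := mul_nonneg hA hM
          linarith
  · have hle : |h| ≤ |t| ^ γ := by
      rw [← hrγ]; exact Real.rpow_le_rpow hr0.le ht.le hγ0.le
    calc _ ≤ (3 * A * |h| * (|t|⁻¹ * (|t| ^ γ)⁻¹ * poissonKer z (|t| ^ γ))) *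
          (2 * M * |t| ^ β) :=
          mul_le_mul (hκ.abs_sub_le h0 hle) hd (abs_nonneg _) (by positivity)
      _ = 6 * A * M * (splitWeight β γ r t * poissonKer z (|t| ^ γ)) := by
          rw [splitWeight, if_neg (not_le.2 ht), Real.rpow_sub htp, Real.rpow_sub_one htp.ne', hrγ]
          field_simp
          ring
      _ ≤ _ := by
          apply mul_le_mul_of_nonneg_left _ (by positivity)
          have := mul_nonneg hS hP2
          linarith

end

/-! ### The boundary kernel -/

lemma rpow_neg_three_halves {ρ : ℝ} (hρ : 0 < ρ) : ρ ^ (-(3 : ℝ) / 2) = (√ρ ^ 3)⁻¹ := by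
  rw [Real.sqrt_eq_rpow, ← Real.rpow_natCast, ← Real.rpow_mul hρ.le, ← Real.rpow_neg hρ.le]
  norm_num

lemma measurable_kconv (c : ℝ) : Measurable (kconv c) := by
  unfold kconv; fun_prop

lemma abs_kconv {c : ℝ} (hc : 0 < c) (u w : ℝ) :
    |kconv c (u, w)| = 8 * c * |u| * |w| * (u ^ 4 + 16 * w ^ 2) ^ (-(3 : ℝ) / 2) := by
  have : 0 ≤ (u ^ 4 + 16 * w ^ 2) ^ (-(3 : ℝ) / 2) := by positivity
  simp only [kconv, abs_mul, abs_of_nonneg this, abs_of_pos hc]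
  norm_num

lemma abs_kconv_le_of_one_le {c : ℝ} (hc : 0 < c) {u w : ℝ} (h : 1 ≤ u ^ 4 + 16 * w ^ 2) :
    |kconv c (u, w)| ≤ 8 * c := by
  rw [abs_kconv hc, rpow_neg_three_halves (by linarith)]
  set s := √(u ^ 4 + 16 * w ^ 2) with hs
  have hs1 : 1 ≤ s := Real.one_le_sqrt.2 h
  have hs2 : s ^ 2 = u ^ 4 + 16 * w ^ 2 := Real.sq_sqrt (by linarith)
  have hw : |w| ≤ s := Real.abs_le_sqrt (by nlinarith [sq_nonneg w, sq_nonneg (u ^ 2)])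
  have hu2 : u ^ 2 ≤ s := Real.le_sqrt_of_sq_le (by nlinarith [sq_nonneg w])
  have hu : |u| ≤ s := abs_le_of_sq_le_sq (by nlinarith) (by linarith)
  have h1 : |u| * |w| ≤ s * s := mul_le_mul hu hw (abs_nonneg _) (by linarith)
  have h2 : |u| * |w| ≤ s ^ 3 := by nlinarith
  have h3 : 0 < s ^ 3 := by positivity
  rw [← div_eq_mul_inv, div_le_iff₀ h3]
  nlinarith

lemma hasDerivAt_kconv_fst (c : ℝ) (u : ℝ) {w : ℝ} (hρ : 0 < u ^ 4 + 16 * w ^ 2) :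
    HasDerivAt (fun u => kconv c (u, w))
      (8 * c * w * (u ^ 4 + 16 * w ^ 2) ^ (-(3 : ℝ) / 2) *
        ((16 * w ^ 2 - 5 * u ^ 4) / (u ^ 4 + 16 * w ^ 2))) u := by
  have h1 : HasDerivAt (fun u : ℝ => u ^ 4 + 16 * w ^ 2) (4 * u ^ 3) u := by
    simpa using (hasDerivAt_pow 4 u).add_const (16 * w ^ 2)
  have h2 := h1.rpow_const (p := -(3 : ℝ) / 2) (Or.inl hρ.ne')
  have h3 : HasDerivAt (fun u : ℝ => 8 * c * u * w) (8 * c * w) u := by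
    simpa using ((hasDerivAt_id u).const_mul (8 * c)).mul_const w
  refine (h3.mul h2).congr_deriv ?_
  rw [Real.rpow_sub_one hρ.ne']
  generalize (u ^ 4 + 16 * w ^ 2) ^ (-(3 : ℝ) / 2) = q
  generalize hr : u ^ 4 + 16 * w ^ 2 = ρ at hρ
  field_simp
  rw [← hr]
  ring

lemma hasDerivAt_kconv_snd (c : ℝ) {u : ℝ} (w : ℝ) (hρ : 0 < u ^ 4 + 16 * w ^ 2) :
    HasDerivAt (fun w => kconv c (u, w))
      (8 * c * u * (u ^ 4 + 16 * w ^ 2) ^ (-(3 : ℝ) / 2) *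
        ((u ^ 4 - 32 * w ^ 2) / (u ^ 4 + 16 * w ^ 2))) w := by
  have h1 : HasDerivAt (fun w : ℝ => u ^ 4 + 16 * w ^ 2) (32 * w) w := by
    refine (((hasDerivAt_pow 2 w).const_mul 16).const_add (u ^ 4)).congr_deriv ?_
    norm_num; ring
  have h2 := h1.rpow_const (p := -(3 : ℝ) / 2) (Or.inl hρ.ne')
  have h3 : HasDerivAt (fun w : ℝ => 8 * c * u * w) (8 * c * u) w := by
    simpa using (hasDerivAt_id w).const_mul (8 * c * u)
  refine (h3.mul h2).congr_deriv ?_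
  rw [Real.rpow_sub_one hρ.ne']
  generalize (u ^ 4 + 16 * w ^ 2) ^ (-(3 : ℝ) / 2) = q
  generalize hr : u ^ 4 + 16 * w ^ 2 = ρ at hρ
  field_simp
  rw [← hr]
  ring

lemma isOddKernel_kconv {c : ℝ} (hc : 0 < c) : IsOddKernel (400 * c) (1 / 2) (kconv c) := by
  have aux : ∀ {u w : ℝ}, w ≠ 0 → ∃ y, 0 < y ∧ |w| ^ (1 / 2 : ℝ) = y ∧ |w| = y ^ 2 ∧
      (u ^ 4 + 16 * w ^ 2) ^ (-(3 : ℝ) / 2) ≤ 8 / (u ^ 2 + y ^ 2) ^ 3 := by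
    intro u w hw
    have hw' := abs_pos.2 hw
    have hy : |w| = √|w| ^ 2 := (Real.sq_sqrt hw'.le).symm
    refine ⟨√|w|, Real.sqrt_pos.2 hw', (Real.sqrt_eq_rpow _).symm, hy, ?_⟩
    rw [← hy]
    have hρ : 0 < u ^ 4 + 16 * w ^ 2 := by positivity
    rw [rpow_neg_three_halves hρ]
    have hD : 0 < u ^ 2 + |w| := by positivity
    have hs : (u ^ 2 + |w|) / 2 ≤ √(u ^ 4 + 16 * w ^ 2) := by
      apply Real.le_sqrt_of_sq_le
      nlinarith [sq_nonneg (u ^ 2 - |w|), sq_abs w, sq_nonneg w, sq_nonneg (u ^ 2)]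
    calc (√(u ^ 4 + 16 * w ^ 2) ^ 3)⁻¹ ≤ (((u ^ 2 + |w|) / 2) ^ 3)⁻¹ := by gcongr
      _ = 8 / (u ^ 2 + |w|) ^ 3 := by field_simp; norm_num
  refine ⟨measurable_kconv c, fun z t => by simp [kconv], ?_, ?_, ?_⟩
  · intro u w hw
    obtain ⟨y, hy, e1, e2, hq⟩ := aux (u := u) hw
    rw [abs_kconv hc, e1, e2, poissonKer]
    have hD : 0 < u ^ 2 + y ^ 2 := by positivity
    refine (mul_le_mul_of_nonneg_left hq (by positivity)).trans ?_
    have h1 : |u| * y ≤ u ^ 2 + y ^ 2 := by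
      nlinarith [sq_nonneg (|u| - y), sq_abs u, sq_nonneg (|u| + y)]
    have h2 : |u| * y * y ^ 2 ≤ (u ^ 2 + y ^ 2) * (u ^ 2 + y ^ 2) :=
      mul_le_mul h1 (by nlinarith [sq_nonneg u]) (by positivity) hD.le
    have e3 : 8 * c * |u| * y ^ 2 * (8 / (u ^ 2 + y ^ 2) ^ 3) =
        64 * c * (|u| * y * y ^ 2) / (y * (u ^ 2 + y ^ 2) ^ 3) := by field_simp; ring
    have e4 : 400 * c * ((y ^ 2)⁻¹ * (y / (u ^ 2 + y ^ 2))) =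
        400 * c * ((u ^ 2 + y ^ 2) * (u ^ 2 + y ^ 2)) / (y * (u ^ 2 + y ^ 2) ^ 3) := by field_simp
    rw [e3, e4]
    gcongr
    norm_num
  · intro u w hw
    obtain ⟨y, hy, e1, e2, hq⟩ := aux (u := u) hw
    have hρ : 0 < u ^ 4 + 16 * w ^ 2 := by positivity
    refine ⟨_, hasDerivAt_kconv_fst c u hρ, ?_⟩
    have hD : 0 < u ^ 2 + y ^ 2 := by positivity
    have h5 : |(16 * w ^ 2 - 5 * u ^ 4) / (u ^ 4 + 16 * w ^ 2)| ≤ 5 := by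
      rw [abs_div, abs_of_pos hρ, div_le_iff₀ hρ, abs_le]
      constructor <;> nlinarith [sq_nonneg w, sq_nonneg (u ^ 2)]
    have h0 : 0 ≤ (u ^ 4 + 16 * w ^ 2) ^ (-(3 : ℝ) / 2) := by positivity
    rw [abs_mul, abs_mul, abs_mul, abs_of_nonneg h0, abs_of_pos (by positivity : 0 < 8 * c),
      e1, e2, poissonKer]
    have h2 : y ^ 4 ≤ (u ^ 2 + y ^ 2) ^ 2 := by
      nlinarith [sq_nonneg u, sq_nonneg y, mul_nonneg (sq_nonneg u) (sq_nonneg y),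
        sq_nonneg (u ^ 2)]
    calc 8 * c * y ^ 2 * (u ^ 4 + 16 * w ^ 2) ^ (-(3 : ℝ) / 2) *
          |(16 * w ^ 2 - 5 * u ^ 4) / (u ^ 4 + 16 * w ^ 2)|
        ≤ 8 * c * y ^ 2 * (8 / (u ^ 2 + y ^ 2) ^ 3) * 5 := by gcongr
      _ = 320 * c * y ^ 4 / (y ^ 2 * (u ^ 2 + y ^ 2) ^ 3) := by field_simp; norm_num
      _ ≤ 400 * c * (u ^ 2 + y ^ 2) ^ 2 / (y ^ 2 * (u ^ 2 + y ^ 2) ^ 3) := by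
          gcongr
          norm_num
      _ = 400 * c * ((y ^ 2)⁻¹ * y⁻¹ * (y / (u ^ 2 + y ^ 2))) := by field_simp
  · intro u w hw
    refine (abs_kconv_le_of_one_le hc ?_).trans (by linarith)
    nlinarith [sq_abs w, sq_nonneg (u ^ 2)]

lemma isOddKernel_kconv_swap {c : ℝ} (hc : 0 < c) :
    IsOddKernel (400 * c) 2 (kconv c ∘ Prod.swap) := by
  have aux : ∀ {u w : ℝ}, u ≠ 0 → 0 < u ^ 4 + 16 * w ^ 2 ∧
      |w| * (u ^ 4 + 16 * w ^ 2) ^ (-(3 : ℝ) / 2) ≤ (w ^ 2 + u ^ 4)⁻¹ ∧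
      u ^ 2 * (u ^ 4 + 16 * w ^ 2) ^ (-(3 : ℝ) / 2) ≤ (w ^ 2 + u ^ 4)⁻¹ := by
    intro u w hu
    have hρ : 0 < u ^ 4 + 16 * w ^ 2 := by positivity
    have hE : 0 < w ^ 2 + u ^ 4 := by positivity
    rw [rpow_neg_three_halves hρ]
    set s := √(u ^ 4 + 16 * w ^ 2) with hs
    have hs0 : 0 < s := Real.sqrt_pos.2 hρ
    have hs2 : s ^ 2 = u ^ 4 + 16 * w ^ 2 := Real.sq_sqrt hρ.le
    have hw : |w| ≤ s := Real.abs_le_sqrt (by nlinarith [sq_nonneg w, sq_nonneg (u ^ 2)])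
    have hu2 : u ^ 2 ≤ s := Real.le_sqrt_of_sq_le (by nlinarith [sq_nonneg w])
    have key : ∀ a, a ≤ s → a * (s ^ 3)⁻¹ ≤ (w ^ 2 + u ^ 4)⁻¹ := by
      intro a ha
      calc a * (s ^ 3)⁻¹ ≤ s * (s ^ 3)⁻¹ := by gcongr
        _ = (s ^ 2)⁻¹ := by field_simp
        _ ≤ _ := by
          apply inv_anti₀ hE
          rw [hs2]; nlinarith [sq_nonneg w]
    exact ⟨hρ, key _ hw, key _ hu2⟩
  have e1 : ∀ u : ℝ, |u| ^ (2 : ℝ) = u ^ 2 := fun u => by rw [Real.rpow_two, sq_abs]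
  refine ⟨(measurable_kconv c).comp measurable_swap, fun z t => by
    simp [kconv, Even.neg_pow (by decide : Even 4)], ?_, ?_, ?_⟩
  · intro w u hu
    obtain ⟨hρ, h1, -⟩ := aux (w := w) hu
    have hu' := abs_pos.2 hu
    rw [Function.comp_apply, Prod.swap_prod_mk, abs_kconv hc, e1, poissonKer]
    calc 8 * c * |u| * |w| * (u ^ 4 + 16 * w ^ 2) ^ (-(3 : ℝ) / 2)
        = 8 * c * |u| * (|w| * (u ^ 4 + 16 * w ^ 2) ^ (-(3 : ℝ) / 2)) := by ring
      _ ≤ 400 * c * |u| * (w ^ 2 + u ^ 4)⁻¹ := by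
          gcongr
          norm_num
      _ = _ := by
          rw [← sq_abs u, ← Even.pow_abs (by decide : Even 4) u]
          field_simp
  · intro w u hu
    obtain ⟨hρ, -, h1⟩ := aux (w := w) hu
    have hu' := abs_pos.2 hu
    refine ⟨_, hasDerivAt_kconv_snd c w hρ, ?_⟩
    have h5 : |(u ^ 4 - 32 * w ^ 2) / (u ^ 4 + 16 * w ^ 2)| ≤ 2 := by
      rw [abs_div, abs_of_pos hρ, div_le_iff₀ hρ, abs_le]
      constructor <;> nlinarith [sq_nonneg w, sq_nonneg (u ^ 2)]
    have h0 : 0 ≤ (u ^ 4 + 16 * w ^ 2) ^ (-(3 : ℝ) / 2) := by positivity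
    rw [abs_mul, abs_mul, abs_mul, abs_of_nonneg h0, abs_of_pos (by positivity : 0 < 8 * c),
      e1, poissonKer]
    calc 8 * c * |u| * (u ^ 4 + 16 * w ^ 2) ^ (-(3 : ℝ) / 2) *
          |(u ^ 4 - 32 * w ^ 2) / (u ^ 4 + 16 * w ^ 2)|
        ≤ 8 * c * |u| * (u ^ 4 + 16 * w ^ 2) ^ (-(3 : ℝ) / 2) * 2 := by gcongr
      _ = 16 * c * |u| * (u ^ 2)⁻¹ * (u ^ 2 * (u ^ 4 + 16 * w ^ 2) ^ (-(3 : ℝ) / 2)) := by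
          field_simp; norm_num
      _ ≤ 400 * c * |u| * (u ^ 2)⁻¹ * (w ^ 2 + u ^ 4)⁻¹ := by
          gcongr
          norm_num
      _ = _ := by
          rw [← sq_abs u, ← Even.pow_abs (by decide : Even 4) u]
          field_simp
  · intro w u hu
    refine (abs_kconv_le_of_one_le hc ?_).trans (by linarith)
    have : 1 ≤ u ^ 2 := by nlinarith [sq_abs u]
    show 1 ≤ u ^ 4 + 16 * w ^ 2
    nlinarith [sq_nonneg w]

/-! ### The operator `K` in symmetrised form -/

lemma IsOddKernel.abs_mul_rpow_le {A γ : ℝ} {κ : ℝ × ℝ → ℝ} (hκ : IsOddKernel A γ κ) (hA : 0 ≤ A)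
    (β : ℝ) (z : ℝ) {t : ℝ} (ht : |t| ≤ 1) :
    |κ (z, t)| * |t| ^ β ≤ A * (splitWeight β γ 1 t * poissonKer z (|t| ^ γ)) := by
  have hP := poissonKer_nonneg (Real.rpow_nonneg (abs_nonneg t) γ) z
  have hS := splitWeight_nonneg (β := β) (γ := γ) one_pos t
  rcases eq_or_ne t 0 with rfl | h0
  · rw [hκ.apply_zero, abs_zero, zero_mul]
    rw [abs_zero] at hP
    exact mul_nonneg hA (mul_nonneg hS hP)
  calc |κ (z, t)| * |t| ^ β
      ≤ A * (|t|⁻¹ * poissonKer z (|t| ^ γ)) * |t| ^ β := by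
        gcongr
        exact hκ.bound z t h0
    _ = _ := by
        rw [splitWeight, if_pos ht, Real.rpow_sub_one (abs_pos.2 h0).ne', div_eq_mul_inv]
        ring

lemma integrable_splitWeight_mul_poissonKer {β γ : ℝ} (hβ : 0 < β) (hγ : β < γ) :
    Integrable fun v : ℝ × ℝ => splitWeight β γ 1 v.2 * poissonKer v.1 (|v.2| ^ γ) :=
  (integrable_mul_poissonKer (y := fun t => |t| ^ γ) (integrable_splitWeight hβ hγ one_pos).1
    (fun t => splitWeight_nonneg one_pos t) (by fun_prop)
    (fun _ ht => Real.rpow_pos_of_pos (abs_pos.2 ht) _)).1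

/-- The unit ball of the homogeneous distance around the origin. -/
def unitBall : Set (ℝ × ℝ) := {v | v.1 ^ 4 + 16 * v.2 ^ 2 < 1}

lemma measurableSet_unitBall : MeasurableSet unitBall :=
  measurableSet_lt (by fun_prop) measurable_const

lemma mem_bhat_one {x y : ℝ × ℝ} : y ∈ bhat 1 x ↔ x - y ∈ unitBall := by
  have h0 : 0 ≤ (x.1 - y.1) ^ 4 + 16 * (x.2 - y.2) ^ 2 := by positivity
  exact Real.rpow_lt_one_iff' h0 (by norm_num)

lemma setIntegral_bhat_one (x : ℝ × ℝ) (F : ℝ × ℝ → ℝ) :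
    ∫ y in bhat 1 x, F (x - y) = ∫ v, unitBall.indicator F v := by
  have hm : MeasurableSet (bhat 1 x) := by
    have : bhat 1 x = (fun y => x - y) ⁻¹' unitBall := Set.ext fun y => mem_bhat_one
    rw [this]
    exact (measurable_const.sub measurable_id) measurableSet_unitBall
  rw [← integral_indicator hm, ← integral_sub_left_eq_self (unitBall.indicator F) volume x]
  refine integral_congr_ae (Eventually.of_forall fun y => ?_)
  by_cases h : y ∈ bhat 1 x
  · simp [h, mem_bhat_one.1 h]
  · simp [h, mt mem_bhat_one.2 h]

lemma setIntegral_compl_bhat_one (x : ℝ × ℝ) (F : ℝ × ℝ → ℝ) :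
    ∫ y in (bhat 1 x)ᶜ, F (x - y) = ∫ v, unitBallᶜ.indicator F v := by
  have hm : MeasurableSet (bhat 1 x)ᶜ := by
    have : bhat 1 x = (fun y => x - y) ⁻¹' unitBall := Set.ext fun y => mem_bhat_one
    rw [this]
    exact ((measurable_const.sub measurable_id) measurableSet_unitBall).compl
  rw [← integral_indicator hm, ← integral_sub_left_eq_self (unitBallᶜ.indicator F) volume x]
  refine integral_congr_ae (Eventually.of_forall fun y => ?_)
  by_cases h : y ∈ bhat 1 x
  · simp [h, mem_bhat_one.1 h]
  · simp [h, mt mem_bhat_one.2 h]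

lemma abs_le_one_of_mem_unitBall {v : ℝ × ℝ} (hv : v ∈ unitBall) : |v.1| ≤ 1 ∧ |v.2| ≤ 1 := by
  have hv' : v.1 ^ 4 + 16 * v.2 ^ 2 < 1 := hv
  have h1 : v.1 ^ 2 ≤ 1 := by nlinarith [sq_nonneg v.2, sq_nonneg (v.1 ^ 2)]
  have h2 : v.2 ^ 2 ≤ 1 := by nlinarith [sq_nonneg v.2, sq_nonneg (v.1 ^ 2)]
  exact ⟨(sq_le_one_iff_abs_le_one _).1 h1, (sq_le_one_iff_abs_le_one _).1 h2⟩

section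

variable {c α L M : ℝ} {g : ℝ × ℝ → ℝ}

lemma integrable_indicator_unitBall (hc : 0 < c) (hα0 : 0 < α) (hα1 : α < 1)
    (hg : IsHolderSupp α (α / 2) L M g) (x : ℝ × ℝ) :
    Integrable (unitBall.indicator fun v => kconv c v * (g (x - v) - g x)) := by
  have hα2 : 0 < α / 2 := by positivity
  have hM := hg.nonneg
  have hgc := hg.continuous hα0 hα2
  have hI1 := integrable_splitWeight_mul_poissonKer (β := α / 2) (γ := 1 / 2) hα2 (by linarith)
  have hI2 := (Measure.measurePreserving_swap (μ := (volume : Measure ℝ))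
    (ν := (volume : Measure ℝ))).integrable_comp_emb
      MeasurableEquiv.prodComm.measurableEmbedding |>.2
    (integrable_splitWeight_mul_poissonKer (β := α) (γ := 2) hα0 (by linarith))
  refine ((hI1.add hI2).const_mul (400 * c * M)).mono' ?_ (Eventually.of_forall fun v => ?_)
  · refine Measurable.aestronglyMeasurable (Measurable.indicator ?_ measurableSet_unitBall)
    exact (measurable_kconv c).mul
      ((hgc.measurable.comp (measurable_const.sub measurable_id)).sub measurable_const)
  · obtain ⟨u, w⟩ := v
    have h400 : 0 ≤ 400 * c := by positivity
    by_cases hv : (u, w) ∈ unitBall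
    · obtain ⟨hu, hw⟩ := abs_le_one_of_mem_unitBall hv
      have k1 := (isOddKernel_kconv hc).abs_mul_rpow_le h400 (α / 2) u hw
      have k2 := (isOddKernel_kconv_swap hc).abs_mul_rpow_le h400 α w hu
      have d1 : |g (x - (u, w)) - g x| ≤ M * |w| ^ (α / 2) + M * |u| ^ α := by
        have e1 := hg.holder₁ (x.1 - u) x.1 (x.2 - w)
        have e2 := hg.holder₂ x.1 (x.2 - w) x.2
        rw [sub_sub_cancel_left, abs_neg] at e1 e2
        have := abs_sub_le (g (x.1 - u, x.2 - w)) (g (x.1, x.2 - w)) (g (x.1, x.2))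
        have e3 : x - (u, w) = (x.1 - u, x.2 - w) := rfl
        rw [e3]
        change |g (x.1 - u, x.2 - w) - g (x.1, x.2)| ≤ _
        linarith
      rw [Set.indicator_of_mem hv, Real.norm_eq_abs, abs_mul]
      have h1 := mul_le_mul_of_nonneg_left d1 (abs_nonneg (kconv c (u, w)))
      have h2 := mul_le_mul_of_nonneg_left k1 hM
      have h3 := mul_le_mul_of_nonneg_left k2 hM
      simp only [Function.comp_apply, Prod.swap_prod_mk, Pi.add_apply] at h1 h2 h3 ⊢
      linarith
    · rw [Set.indicator_of_notMem hv, norm_zero]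
      refine mul_nonneg (by positivity) (add_nonneg ?_ ?_)
      · exact mul_nonneg (splitWeight_nonneg one_pos _)
          (poissonKer_nonneg (Real.rpow_nonneg (abs_nonneg _) _) _)
      · exact mul_nonneg (splitWeight_nonneg one_pos _)
          (poissonKer_nonneg (Real.rpow_nonneg (abs_nonneg _) _) _)

lemma integrable_indicator_compl_unitBall (hc : 0 < c) (hα0 : 0 < α)
    (hg : IsHolderSupp α (α / 2) L M g) (x : ℝ × ℝ) :
    Integrable (unitBallᶜ.indicator fun v => kconv c v * g (x - v)) := by
  have hα2 : 0 < α / 2 := by positivity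
  have hM := hg.nonneg
  have hgc := hg.continuous hα0 hα2
  refine (((integrable_boxInd L).comp_sub_left x).const_mul (8 * c * M)).mono' ?_
    (Eventually.of_forall fun v => ?_)
  · refine Measurable.aestronglyMeasurable (Measurable.indicator ?_ measurableSet_unitBall.compl)
    exact (measurable_kconv c).mul (hgc.measurable.comp (measurable_const.sub measurable_id))
  · by_cases hv : v ∈ unitBall
    · rw [Set.indicator_of_notMem (by simpa using hv), norm_zero]
      exact mul_nonneg (by positivity) (boxInd_nonneg _ _)
    · rw [Set.indicator_of_mem (by simpa using hv), Real.norm_eq_abs, abs_mul, mul_assoc (8 * c)]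
      exact mul_le_mul (abs_kconv_le_of_one_le hc (not_lt.1 hv))
        (hg.abs_le_boxInd (by simp) (by simp)) (abs_nonneg _) (by positivity)

lemma Kop_eq_half_integral (hc : 0 < c) (hα0 : 0 < α) (hα1 : α < 1)
    (hg : IsHolderSupp α (α / 2) L M g) {T : ℝ × ℝ → ℝ × ℝ} (hT : MeasurePreserving T)
    (hTe : MeasurableEmbedding T) (hTk : ∀ v, kconv c (T v) = -kconv c v)
    (hTb : ∀ v, T v ∈ unitBall ↔ v ∈ unitBall) (x : ℝ × ℝ) :
    Kop c g x = 1 / 2 * ∫ v, kconv c v * (g (x - v) - g (x - T v)) := by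
  set F : ℝ × ℝ → ℝ := unitBall.indicator fun v => kconv c v * (g (x - v) - g x) with hF
  set G : ℝ × ℝ → ℝ := unitBallᶜ.indicator fun v => kconv c v * g (x - v) with hG
  have hFi : Integrable F := integrable_indicator_unitBall hc hα0 hα1 hg x
  have hGi : Integrable G := integrable_indicator_compl_unitBall hc hα0 hg x
  have hFT : Integrable fun v => F (T v) := (hT.integrable_comp_emb hTe).2 hFi
  have hGT : Integrable fun v => G (T v) := (hT.integrable_comp_emb hTe).2 hGi
  have hK : Kop c g x = ∫ v, F v + G v := by
    rw [integral_add hFi hGi, hF, hG, ← setIntegral_bhat_one x, ← setIntegral_compl_bhat_one x]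
    simp only [sub_sub_cancel]
    rfl
  have hKT : ∫ v, F (T v) + G (T v) = ∫ v, F v + G v :=
    hT.integral_comp hTe fun v => F v + G v
  have hsum : ∫ v, kconv c v * (g (x - v) - g (x - T v)) =
      ∫ v, (F v + G v) + (F (T v) + G (T v)) := by
    refine integral_congr_ae (Eventually.of_forall fun v => ?_)
    by_cases hv : v ∈ unitBall
    · have hv' := (hTb v).2 hv
      simp only [hF, hG, Set.indicator_of_mem hv, Set.indicator_of_mem hv', hTk,
        Set.indicator_of_notMem (Set.notMem_compl_iff.2 hv),
        Set.indicator_of_notMem (Set.notMem_compl_iff.2 hv')]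
      ring
    · have hv' := mt (hTb v).1 hv
      simp only [hF, hG, Set.indicator_of_notMem hv, Set.indicator_of_notMem hv', hTk,
        Set.indicator_of_mem (Set.mem_compl hv), Set.indicator_of_mem (Set.mem_compl hv')]
      ring
  have h1 : Integrable fun v => F v + G v := hFi.add hGi
  have h2 : Integrable fun v => F (T v) + G (T v) := hFT.add hGT
  rw [hsum, integral_add h1 h2, hKT, hK]
  ring

lemma Kop_eq_symOp (hc : 0 < c) (hα0 : 0 < α) (hα1 : α < 1)
    (hg : IsHolderSupp α (α / 2) L M g) (x : ℝ × ℝ) :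
    Kop c g x = 1 / 2 * symOp (kconv c) g x :=
  Kop_eq_half_integral hc hα0 hα1 hg measurePreserving_reflSnd measurableEmbedding_reflSnd
    (fun v => by simp [kconv, reflSnd]) (fun v => by simp [unitBall, reflSnd]) x

lemma Kop_eq_symOp_swap (hc : 0 < c) (hα0 : 0 < α) (hα1 : α < 1)
    (hg : IsHolderSupp α (α / 2) L M g) (x : ℝ × ℝ) :
    Kop c g x = 1 / 2 * symOp (kconv c ∘ Prod.swap) (g ∘ Prod.swap) x.swap := by
  have hs : MeasurePreserving (Prod.swap : ℝ × ℝ → ℝ × ℝ) := Measure.measurePreserving_swap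
  have hse : MeasurableEmbedding (Prod.swap : ℝ × ℝ → ℝ × ℝ) :=
    MeasurableEquiv.prodComm.measurableEmbedding
  have h4 : ∀ a : ℝ, (-a) ^ 4 = a ^ 4 := fun a => by ring
  rw [Kop_eq_half_integral (T := Prod.swap ∘ reflSnd ∘ Prod.swap) hc hα0 hα1 hg
    (hs.comp (measurePreserving_reflSnd.comp hs)) (hse.comp (measurableEmbedding_reflSnd.comp hse))
    (fun v => by simp [kconv, reflSnd, h4]) (fun v => by simp [unitBall, reflSnd, h4]) x,
    ← hs.integral_comp hse]
  rfl

/-- `K` is bounded from Hölder functions with support in a fixed box to Hölder functions. -/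
lemma exists_Kop_bound (hc : 0 < c) (hα0 : 0 < α) (hα1 : α < 1) (L : ℝ) :
    ∃ C, 0 ≤ C ∧ ∀ g M, IsHolderSupp α (α / 2) L M g →
      (∀ x, |Kop c g x| ≤ C * M) ∧
      (∀ a a' b, |Kop c g (a, b) - Kop c g (a', b)| ≤ C * M * |a - a'| ^ α) ∧
      (∀ a b b', |Kop c g (a, b) - Kop c g (a, b')| ≤ C * M * |b - b'| ^ (α / 2)) := by
  have hα2 : 0 < α / 2 := by positivity
  have hα12 : α / 2 < 1 / 2 := by linarith
  have h400 : 0 ≤ 400 * c := by positivity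
  have hp1 : 0 < 1 / 2 - α / 2 := by linarith
  have hp2 : 0 < 2 - α := by linarith
  have hI : 0 ≤ ∫ v, boxInd L v := integral_nonneg (boxInd_nonneg L)
  set C₁ := 400 * c * (4 * Real.pi * (1 / (α / 2) + 1 / (1 / 2 - α / 2)) + 2 * ∫ v, boxInd L v)
    with hC1
  set C₂ := 400 * c * (24 * Real.pi * (1 / (α / 2) + 1 / (1 / 2 - α / 2))) with hC2
  set C₃ := 400 * c * (24 * Real.pi * (1 / α + 1 / (2 - α))) with hC3
  have hC1' : 0 ≤ C₁ := by positivity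
  have hC2' : 0 ≤ C₂ := by positivity
  have hC3' : 0 ≤ C₃ := by positivity
  refine ⟨C₁ + C₂ + C₃, by positivity, fun g M hg => ⟨fun x => ?_, fun a a' b => ?_,
    fun a b b' => ?_⟩⟩
  · have h := (isOddKernel_kconv hc).abs_symOp_le h400 hα2 hα12 (by linarith) hg x
    have hM := hg.nonneg
    rw [Kop_eq_symOp hc hα0 hα1 hg, abs_mul, abs_of_pos (one_half_pos (α := ℝ))]
    have h1 : |symOp (kconv c) g x| ≤ C₁ * M := h.trans_eq (by rw [hC1]; ring)
    nlinarith [abs_nonneg (symOp (kconv c) g x), mul_nonneg hC2' hM, mul_nonneg hC3' hM]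
  · have h := (isOddKernel_kconv hc).holder_symOp h400 hα2 hα0 hα12 (by linarith) hg a a' b
    have hM := hg.nonneg
    rw [Kop_eq_symOp hc hα0 hα1 hg, Kop_eq_symOp hc hα0 hα1 hg, ← mul_sub, abs_mul,
      abs_of_pos (one_half_pos (α := ℝ))]
    have e : α / 2 / (1 / 2) = α := by ring
    rw [e] at h
    have hr : 0 ≤ |a - a'| ^ α := by positivity
    have h1 := h.trans_eq (show _ = C₂ * M * |a - a'| ^ α by rw [hC2]; ring)
    have h2 : 0 ≤ C₁ * M * |a - a'| ^ α := by positivity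
    have h3 : 0 ≤ C₂ * M * |a - a'| ^ α := by positivity
    have h4 : 0 ≤ C₃ * M * |a - a'| ^ α := by positivity
    linarith
  · have h := (isOddKernel_kconv_swap hc).holder_symOp h400 hα0 hα2 (by linarith) hα1.le hg.swap
      b b' a
    have hM := hg.nonneg
    rw [Kop_eq_symOp_swap hc hα0 hα1 hg, Kop_eq_symOp_swap hc hα0 hα1 hg, ← mul_sub, abs_mul,
      abs_of_pos (one_half_pos (α := ℝ))]
    have hr : 0 ≤ |b - b'| ^ (α / 2) := by positivity
    have h1 := h.trans_eq (show _ = C₃ * M * |b - b'| ^ (α / 2) by rw [hC3]; ring)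
    have h2 : 0 ≤ C₁ * M * |b - b'| ^ (α / 2) := by positivity
    have h3 : 0 ≤ C₂ * M * |b - b'| ^ (α / 2) := by positivity
    have h4 : 0 ≤ C₃ * M * |b - b'| ^ (α / 2) := by positivity
    simp only [Prod.swap_prod_mk] at h1 ⊢
    linarith

lemma hasDerivAt_Kop_line (hc : 0 < c) (hα0 : 0 < α) (hα1 : α < 1)
    (hg : IsHolderSupp α (α / 2) L M g) {g' : ℝ × ℝ → ℝ} (hg' : IsHolderSupp α (α / 2) L M g')
    {e : ℝ × ℝ} (he1 : |e.1| ≤ 1) (he2 : |e.2| ≤ 1)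
    (hd : ∀ p s, HasDerivAt (fun s : ℝ => g (p + s • e)) (g' (p + s • e)) s)
    (x : ℝ × ℝ) (s₀ : ℝ) :
    HasDerivAt (fun s : ℝ => Kop c g (x + s • e)) (Kop c g' (x + s₀ • e)) s₀ := by
  simp only [Kop_eq_symOp hc hα0 hα1 hg, Kop_eq_symOp hc hα0 hα1 hg']
  exact ((isOddKernel_kconv hc).hasDerivAt_symOp (by positivity) (half_pos hα0) hα0 (by linarith)
    (by linarith) hg hg' he1 he2 hd x s₀).const_mul _

lemma hasDerivAt_Kop_fst (hc : 0 < c) (hα0 : 0 < α) (hα1 : α < 1)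
    (hg : IsHolderSupp α (α / 2) L M g) {g' : ℝ × ℝ → ℝ} (hg' : IsHolderSupp α (α / 2) L M g')
    (hd : ∀ a b, HasDerivAt (fun s => g (s, b)) (g' (a, b)) a) (a b : ℝ) :
    HasDerivAt (fun s => Kop c g (s, b)) (Kop c g' (a, b)) a := by
  have := hasDerivAt_Kop_line (e := (1, 0)) hc hα0 hα1 hg hg' (by simp) (by simp) ?_ (0, b) a
  · simpa using this
  · intro p s
    have := (hd (p.1 + s) p.2).comp_const_add p.1 s
    refine (this.congr_of_eventuallyEq (Eventually.of_forall fun s => ?_)).congr_deriv ?_ <;>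
    · congr 1; ext <;> simp

lemma hasDerivAt_Kop_snd (hc : 0 < c) (hα0 : 0 < α) (hα1 : α < 1)
    (hg : IsHolderSupp α (α / 2) L M g) {g' : ℝ × ℝ → ℝ} (hg' : IsHolderSupp α (α / 2) L M g')
    (hd : ∀ a b, HasDerivAt (fun s => g (a, s)) (g' (a, b)) b) (a b : ℝ) :
    HasDerivAt (fun s => Kop c g (a, s)) (Kop c g' (a, b)) b := by
  have := hasDerivAt_Kop_line (e := (0, 1)) hc hα0 hα1 hg hg' (by simp) (by simp) ?_ (a, 0) b
  · simpa using this
  · intro p s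
    have := (hd p.1 (p.2 + s)).comp_const_add p.2 s
    refine (this.congr_of_eventuallyEq (Eventually.of_forall fun s => ?_)).congr_deriv ?_ <;>
    · congr 1; ext <;> simp

end

/-! ### The homogeneous distance and the `C^{2,α}` norm -/

lemma dt_nonneg (p q : ℝ × ℝ) : 0 ≤ dt p q := Real.rpow_nonneg (by positivity) _

lemma dt_fst (a a' b : ℝ) : dt (a, b) (a', b) = |a - a'| := by
  have h : (a - a') ^ 4 + 16 * (b - b) ^ 2 = |a - a'| ^ (4 : ℝ) := by
    rw [sub_self, ← Even.pow_abs (by decide : Even 4)]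
    norm_cast
    ring
  change ((a - a') ^ 4 + 16 * (b - b) ^ 2) ^ ((1 : ℝ) / 4) = _
  rw [h, ← Real.rpow_mul (abs_nonneg _)]
  norm_num

lemma dt_snd (a b b' : ℝ) : dt (a, b) (a, b') = 2 * |b - b'| ^ ((1 : ℝ) / 2) := by
  have h : (a - a) ^ 4 + 16 * (b - b') ^ 2 = (2 : ℝ) ^ (4 : ℝ) * |b - b'| ^ (2 : ℝ) := by
    rw [sub_self, ← sq_abs (b - b')]
    norm_cast
    ring
  change ((a - a) ^ 4 + 16 * (b - b') ^ 2) ^ ((1 : ℝ) / 4) = _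
  rw [h, Real.mul_rpow (by positivity) (by positivity), ← Real.rpow_mul (by norm_num),
    ← Real.rpow_mul (abs_nonneg _)]
  norm_num

lemma abs_fst_sub_le_dt (p q : ℝ × ℝ) : |p.1 - q.1| ≤ dt p q := by
  rw [← dt_fst p.1 q.1 p.2]
  refine Real.rpow_le_rpow (by positivity) ?_ (by norm_num)
  simp only [sub_self]
  nlinarith [sq_nonneg (p.2 - q.2)]

lemma abs_snd_sub_rpow_le_dt (p q : ℝ × ℝ) : 2 * |p.2 - q.2| ^ ((1 : ℝ) / 2) ≤ dt p q := by
  rw [← dt_snd p.1 p.2 q.2]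
  refine Real.rpow_le_rpow (by positivity) ?_ (by norm_num)
  simp only [sub_self]
  have : 0 ≤ (p.1 - q.1) ^ 4 := by positivity
  linarith

lemma abs_snd_sub_rpow_half_le {α : ℝ} (hα : 0 ≤ α) (p q : ℝ × ℝ) :
    |p.2 - q.2| ^ (α / 2) ≤ dt p q ^ α := by
  have h0 : 0 ≤ |p.2 - q.2| ^ ((1 : ℝ) / 2) := by positivity
  have h := abs_snd_sub_rpow_le_dt p q
  calc |p.2 - q.2| ^ (α / 2) = (|p.2 - q.2| ^ ((1 : ℝ) / 2)) ^ α := by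
        rw [← Real.rpow_mul (abs_nonneg _)]
        congr 1
        ring
    _ ≤ _ := Real.rpow_le_rpow h0 (by linarith) hα

lemma dt_snd_rpow_le {α : ℝ} (hα1 : α ≤ 1) (a b b' : ℝ) :
    dt (a, b) (a, b') ^ α ≤ 2 * |b - b'| ^ (α / 2) := by
  rw [dt_snd, Real.mul_rpow (by norm_num) (by positivity), ← Real.rpow_mul (abs_nonneg _)]
  have h2 : (2 : ℝ) ^ α ≤ 2 := by
    simpa using Real.rpow_le_rpow_of_exponent_le (one_le_two : (1 : ℝ) ≤ 2) hα1
  have h3 : (1 : ℝ) / 2 * α = α / 2 := by ring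
  rw [h3]
  gcongr

lemma dt_pos {p q : ℝ × ℝ} (h : p ≠ q) : 0 < dt p q := by
  refine (dt_nonneg p q).lt_of_ne' fun h0 => h ?_
  have h1 := abs_fst_sub_le_dt p q
  have h2 := abs_snd_sub_rpow_le_dt p q
  rw [h0] at h1 h2
  refine Prod.ext (sub_eq_zero.1 (abs_nonpos_iff.1 h1)) (sub_eq_zero.1 ?_)
  by_contra h3
  have := Real.rpow_pos_of_pos (abs_pos.2 h3) (1 / 2)
  linarith

lemma Bdd.abs_le_supAbs {h : ℝ × ℝ → ℝ} (hb : Bdd h) (p : ℝ × ℝ) : |h p| ≤ supAbs h := by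
  obtain ⟨M, hM⟩ := hb
  refine le_csSup ⟨M, ?_⟩ ⟨p, rfl⟩
  rintro _ ⟨q, rfl⟩
  exact hM q

lemma supAbs_nonneg (h : ℝ × ℝ → ℝ) : 0 ≤ supAbs h := by
  refine Real.sSup_nonneg ?_
  rintro _ ⟨p, rfl⟩
  exact abs_nonneg _

lemma supAbs_le {h : ℝ × ℝ → ℝ} {C : ℝ} (hC : ∀ p, |h p| ≤ C) : supAbs h ≤ C := by
  refine Real.sSup_le ?_ ((abs_nonneg _).trans (hC 0))
  rintro _ ⟨p, rfl⟩
  exact hC p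

lemma holderSemi_nonneg (α : ℝ) (h : ℝ × ℝ → ℝ) : 0 ≤ holderSemi α h := by
  refine Real.sSup_nonneg ?_
  rintro _ ⟨p, q, -, rfl⟩
  exact div_nonneg (abs_nonneg _) (Real.rpow_nonneg (dt_nonneg _ _) _)

lemma holderSemi_le {α C : ℝ} {h : ℝ × ℝ → ℝ} (hC0 : 0 ≤ C)
    (hC : ∀ p q, |h p - h q| ≤ C * dt p q ^ α) : holderSemi α h ≤ C := by
  refine Real.sSup_le ?_ hC0
  rintro _ ⟨p, q, hpq, rfl⟩
  exact (div_le_iff₀ (Real.rpow_pos_of_pos (dt_pos hpq) _)).2 (hC p q)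

lemma abs_sub_le_holderSemi {α : ℝ} {h : ℝ × ℝ → ℝ}
    (hh : ∃ M, ∀ p q, |h p - h q| ≤ M * dt p q ^ α) (p q : ℝ × ℝ) :
    |h p - h q| ≤ holderSemi α h * dt p q ^ α := by
  rcases eq_or_ne p q with rfl | hpq
  · rw [sub_self, abs_zero]
    exact mul_nonneg (holderSemi_nonneg _ _) (Real.rpow_nonneg (dt_nonneg _ _) _)
  · obtain ⟨M, hM⟩ := hh
    refine (div_le_iff₀ (Real.rpow_pos_of_pos (dt_pos hpq) _)).1 (le_csSup ⟨M, ?_⟩ ?_)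
    · rintro _ ⟨p, q, hpq, rfl⟩
      exact (div_le_iff₀ (Real.rpow_pos_of_pos (dt_pos hpq) _)).2 (hM p q)
    · exact ⟨p, q, hpq, rfl⟩

/-! ### Functions of class `C^{2,α}` with bounded support -/

lemma le_mul_rpow_of_le {x B t β : ℝ} (hB : 0 ≤ B) (ht : 0 ≤ t) (hβ0 : 0 < β) (hβ1 : β ≤ 1)
    (h1 : x ≤ B) (h2 : x ≤ B * t) : x ≤ B * t ^ β := by
  rcases le_total t 1 with h | h
  · exact h2.trans (mul_le_mul_of_nonneg_left (Real.self_le_rpow_of_le_one ht h hβ1) hB)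
  · exact h1.trans (le_mul_of_one_le_right hB (Real.one_le_rpow h hβ0.le))

lemma abs_sub_le_of_hasDerivAt {φ φ' : ℝ → ℝ} {N : ℝ} (hd : ∀ s, HasDerivAt φ (φ' s) s)
    (hN : ∀ s, |φ' s| ≤ N) (a a' : ℝ) : |φ a - φ a'| ≤ N * |a - a'| :=
  convex_univ.norm_image_sub_le_of_norm_hasDerivWithin_le
    (fun s _ => (hd s).hasDerivWithinAt) (fun s _ => hN s) (Set.mem_univ _) (Set.mem_univ _)

/-- First order Taylor estimate for a function with Lipschitz derivative. -/
lemma abs_sub_sub_mul_le {φ φ' : ℝ → ℝ} {N : ℝ} (hd : ∀ s, HasDerivAt φ (φ' s) s)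
    (hN : ∀ s s', |φ' s - φ' s'| ≤ N * |s - s'|) (a : ℝ) {t : ℝ} (ht : 0 ≤ t) :
    |φ (a + t) - φ a - t * φ' a| ≤ N * t ^ 2 := by
  have hN0 : 0 ≤ N := by
    have := (abs_nonneg _).trans (hN 1 0)
    simpa using this
  have h := (convex_Icc a (a + t)).norm_image_sub_le_of_norm_hasDerivWithin_le
    (f := fun s => φ s - s * φ' a) (f' := fun s => φ' s - 1 * φ' a) (C := N * t)
    (fun s _ => ((hd s).sub ((hasDerivAt_id s).mul_const (φ' a))).hasDerivWithinAt)
    (fun s hs => ?_) (Set.left_mem_Icc.2 (by linarith)) (Set.right_mem_Icc.2 (by linarith))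
  · rw [Real.norm_eq_abs, Real.norm_eq_abs, add_sub_cancel_left, abs_of_nonneg ht] at h
    convert h using 1
    · congr 1
      ring
    · ring
  · rw [one_mul, Real.norm_eq_abs]
    refine (hN s a).trans (mul_le_mul_of_nonneg_left ?_ hN0)
    rw [abs_of_nonneg (by linarith [hs.1])]
    linarith [hs.2]

lemma box_of_d2_ne_zero {L : ℝ} {g : ℝ × ℝ → ℝ} (hg : ∀ p, g p ≠ 0 → |p.1| ≤ L ∧ |p.2| ≤ L)
    (p : ℝ × ℝ) (hp : d2 g p ≠ 0) : |p.1| ≤ L ∧ |p.2| ≤ L := by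
  by_contra h
  refine hp ?_
  have hz : (fun s => g (s, p.2)) =ᶠ[nhds p.1] fun _ => 0 := by
    rcases not_and_or.1 h with h | h
    · filter_upwards [(continuous_abs.tendsto p.1).eventually_const_lt (not_le.1 h)] with s hs
      by_contra h0
      exact hs.not_ge (hg _ h0).1
    · refine Eventually.of_forall fun s => ?_
      by_contra h0
      exact h (hg _ h0).2
  rw [d2, hz.deriv_eq, deriv_const]

lemma box_of_d3_ne_zero {L : ℝ} {g : ℝ × ℝ → ℝ} (hg : ∀ p, g p ≠ 0 → |p.1| ≤ L ∧ |p.2| ≤ L)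
    (p : ℝ × ℝ) (hp : d3 g p ≠ 0) : |p.1| ≤ L ∧ |p.2| ≤ L :=
  (box_of_d2_ne_zero (g := g ∘ Prod.swap) (fun q hq => (hg q.swap hq).symm) p.swap hp).symm

lemma box_of_mem_bhat {R : ℝ} {p : ℝ × ℝ} (hp : p ∈ bhat R 0) :
    |p.1| ≤ R + R ^ 2 ∧ |p.2| ≤ R + R ^ 2 := by
  have hR : dt 0 p < R := hp
  have h1 := abs_fst_sub_le_dt 0 p
  have h2 := abs_snd_sub_rpow_le_dt 0 p
  have h3 : (|p.2| ^ ((1 : ℝ) / 2)) ^ 2 = |p.2| := by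
    rw [← Real.sqrt_eq_rpow, Real.sq_sqrt (abs_nonneg _)]
  simp only [Prod.fst_zero, Prod.snd_zero, zero_sub, abs_neg] at h1 h2
  have h4 : 0 ≤ |p.2| ^ ((1 : ℝ) / 2) := by positivity
  have h5 := abs_nonneg p.1
  exact ⟨by nlinarith, by nlinarith⟩

section

variable {α L : ℝ} {f : ℝ × ℝ → ℝ}

lemma c2aNorm_nonneg : 0 ≤ c2aNorm α f := by
  have := supAbs_nonneg f
  have := supAbs_nonneg (d2 f)
  have := supAbs_nonneg (d2 (d2 f))
  have := supAbs_nonneg (d3 f)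
  have := holderSemi_nonneg α (d2 (d2 f))
  have := holderSemi_nonneg α (d3 f)
  unfold c2aNorm
  linarith

lemma C2aClass.bounds (hf : C2aClass α f) :
    (∀ p, |f p| ≤ c2aNorm α f) ∧ (∀ p, |d2 f p| ≤ c2aNorm α f) ∧
    (∀ p, |d2 (d2 f) p| ≤ c2aNorm α f) ∧ (∀ p, |d3 f p| ≤ c2aNorm α f) ∧
    (∀ p q, |d2 (d2 f) p - d2 (d2 f) q| ≤ c2aNorm α f * dt p q ^ α) ∧
    (∀ p q, |d3 f p - d3 f q| ≤ c2aNorm α f * dt p q ^ α) := by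
  obtain ⟨b0, -, -, -, -, -, -, b1, b2, b3, h2, h3⟩ := hf
  have n0 := supAbs_nonneg f
  have n1 := supAbs_nonneg (d2 f)
  have n2 := supAbs_nonneg (d2 (d2 f))
  have n3 := supAbs_nonneg (d3 f)
  have n4 := holderSemi_nonneg α (d2 (d2 f))
  have n5 := holderSemi_nonneg α (d3 f)
  have hN : c2aNorm α f = supAbs f + supAbs (d2 f) + supAbs (d2 (d2 f)) + supAbs (d3 f) +
    holderSemi α (d2 (d2 f)) + holderSemi α (d3 f) := rfl
  refine ⟨fun p => (b0.abs_le_supAbs p).trans ?_, fun p => (b1.abs_le_supAbs p).trans ?_,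
    fun p => (b2.abs_le_supAbs p).trans ?_, fun p => (b3.abs_le_supAbs p).trans ?_,
    fun p q => (abs_sub_le_holderSemi h2 p q).trans
      (mul_le_mul_of_nonneg_right ?_ (Real.rpow_nonneg (dt_nonneg p q) α)),
    fun p q => (abs_sub_le_holderSemi h3 p q).trans
      (mul_le_mul_of_nonneg_right ?_ (Real.rpow_nonneg (dt_nonneg p q) α))⟩ <;> linarith

lemma isHolderSupp_of_dt_holder {N : ℝ} {h : ℝ × ℝ → ℝ} (hα1 : α < 1) (hb : ∀ p, |h p| ≤ N)
    (hh : ∀ p q, |h p - h q| ≤ N * dt p q ^ α) (hs : ∀ p, h p ≠ 0 → |p.1| ≤ L ∧ |p.2| ≤ L) :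
    IsHolderSupp α (α / 2) L (8 * N) h := by
  have hN : 0 ≤ N := (abs_nonneg _).trans (hb 0)
  refine ⟨fun p => (hb p).trans (by linarith), fun a a' b => ?_, fun a b b' => ?_, hs⟩
  · refine (hh (a, b) (a', b)).trans ?_
    rw [dt_fst]
    gcongr
    linarith
  · have h1 := mul_le_mul_of_nonneg_left (dt_snd_rpow_le hα1.le a b b') hN
    have h2 : 0 ≤ N * |b - b'| ^ (α / 2) := by positivity
    linarith [hh (a, b) (a, b')]

lemma isHolderSupp_of_lipschitz {N : ℝ} {h : ℝ × ℝ → ℝ} (hα0 : 0 < α) (hα1 : α < 1)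
    (hb : ∀ p, |h p| ≤ N) (h1 : ∀ a a' b, |h (a, b) - h (a', b)| ≤ N * |a - a'|)
    (h2 : ∀ a b b', |h (a, b) - h (a, b')| ≤ 4 * N * |b - b'| ^ ((1 : ℝ) / 2))
    (hs : ∀ p, h p ≠ 0 → |p.1| ≤ L ∧ |p.2| ≤ L) :
    IsHolderSupp α (α / 2) L (8 * N) h := by
  have hN : 0 ≤ N := (abs_nonneg _).trans (hb 0)
  have hsub : ∀ p q, |h p - h q| ≤ 8 * N := fun p q => by
    linarith [abs_sub (h p) (h q), hb p, hb q]
  refine ⟨fun p => (hb p).trans (by linarith), fun a a' b => ?_, fun a b b' => ?_, hs⟩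
  · refine le_mul_rpow_of_le (by positivity) (abs_nonneg _) hα0 hα1.le (hsub _ _) ?_
    exact (h1 a a' b).trans (by gcongr; linarith)
  · have h3 : |b - b'| ^ (α / 2) = (|b - b'| ^ ((1 : ℝ) / 2)) ^ α := by
      rw [← Real.rpow_mul (abs_nonneg _)]
      congr 1
      ring
    rw [h3]
    refine le_mul_rpow_of_le (by positivity) (by positivity) hα0 hα1.le (hsub _ _) ?_
    exact (h2 a b b').trans (by gcongr; norm_num)

lemma C2aClass.hasDerivAt_fst (hf : C2aClass α f) (a b : ℝ) :
    HasDerivAt (fun s => f (s, b)) (d2 f (a, b)) a :=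
  (hf.2.1 (a, b)).hasDerivAt

lemma C2aClass.hasDerivAt_d2_fst (hf : C2aClass α f) (a b : ℝ) :
    HasDerivAt (fun s => d2 f (s, b)) (d2 (d2 f) (a, b)) a :=
  (hf.2.2.1 (a, b)).hasDerivAt

lemma C2aClass.hasDerivAt_snd (hf : C2aClass α f) (a b : ℝ) :
    HasDerivAt (fun s => f (a, s)) (d3 f (a, b)) b :=
  (hf.2.2.2.1 (a, b)).hasDerivAt

/-- The first derivative `∂₂f` is `1/2`-Hölder in the second variable, by interpolation. -/
lemma C2aClass.abs_d2_sub_le (hf : C2aClass α f) (a b b' : ℝ) :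
    |d2 f (a, b) - d2 f (a, b')| ≤ 4 * c2aNorm α f * |b - b'| ^ ((1 : ℝ) / 2) := by
  set N := c2aNorm α f
  obtain ⟨-, -, b2, b3, -, -⟩ := hf.bounds
  set t := |b - b'| ^ ((1 : ℝ) / 2) with ht
  have ht0 : 0 ≤ t := by positivity
  have htt : t ^ 2 = |b - b'| := by
    rw [ht, ← Real.sqrt_eq_rpow, Real.sq_sqrt (abs_nonneg _)]
  rcases ht0.eq_or_lt with h0 | h0
  · have hb : b = b' := by
      rw [← h0, eq_comm] at htt
      simpa [sub_eq_zero] using htt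
    rw [hb, sub_self, abs_zero, ← h0, mul_zero]
  have taylor : ∀ b, |f (a + t, b) - f (a, b) - t * d2 f (a, b)| ≤ N * t ^ 2 := fun b =>
    abs_sub_sub_mul_le (φ := fun s => f (s, b)) (φ' := fun s => d2 f (s, b))
      (fun s => hf.hasDerivAt_fst s b)
      (fun s s' => abs_sub_le_of_hasDerivAt (fun r => hf.hasDerivAt_d2_fst r b)
        (fun r => b2 (r, b)) s s') a ht0
  have lip : ∀ a, |f (a, b) - f (a, b')| ≤ N * t ^ 2 := fun a => by
    rw [htt]
    exact abs_sub_le_of_hasDerivAt (fun r => hf.hasDerivAt_snd a r) (fun r => b3 (a, r)) b b'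
  have h1 := abs_le.1 (taylor b)
  have h2 := abs_le.1 (taylor b')
  have h3 := abs_le.1 (lip a)
  have h4 := abs_le.1 (lip (a + t))
  refine le_of_mul_le_mul_left ?_ h0
  rw [← abs_of_pos h0, ← abs_mul, abs_of_pos h0, abs_le]
  constructor <;> nlinarith

lemma C2aClass.isHolderSupp (hα0 : 0 < α) (hα1 : α < 1) (hf : C2aClass α f)
    (hs : ∀ p, f p ≠ 0 → |p.1| ≤ L ∧ |p.2| ≤ L) :
    IsHolderSupp α (α / 2) L (8 * c2aNorm α f) f ∧
    IsHolderSupp α (α / 2) L (8 * c2aNorm α f) (d2 f) ∧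
    IsHolderSupp α (α / 2) L (8 * c2aNorm α f) (d2 (d2 f)) ∧
    IsHolderSupp α (α / 2) L (8 * c2aNorm α f) (d3 f) := by
  obtain ⟨b0, b1, b2, b3, h2, h3⟩ := hf.bounds
  have hs1 := box_of_d2_ne_zero hs
  refine ⟨?_, ?_, isHolderSupp_of_dt_holder hα1 b2 h2 (box_of_d2_ne_zero hs1),
    isHolderSupp_of_dt_holder hα1 b3 h3 (box_of_d3_ne_zero hs)⟩
  · refine isHolderSupp_of_lipschitz hα0 hα1 b0 (fun a a' b => abs_sub_le_of_hasDerivAt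
      (fun r => hf.hasDerivAt_fst r b) (fun r => b1 (r, b)) a a') (fun a b b' => ?_) hs
    have hN : 0 ≤ c2aNorm α f := c2aNorm_nonneg
    refine le_mul_rpow_of_le (by positivity) (abs_nonneg _) (by norm_num) (by norm_num) ?_ ?_
    · linarith [abs_sub (f (a, b)) (f (a, b')), b0 (a, b), b0 (a, b')]
    · refine (abs_sub_le_of_hasDerivAt (fun r => hf.hasDerivAt_snd a r)
        (fun r => b3 (a, r)) b b').trans ?_
      gcongr
      linarith
  · exact isHolderSupp_of_lipschitz hα0 hα1 b1 (fun a a' b => abs_sub_le_of_hasDerivAt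
      (fun r => hf.hasDerivAt_d2_fst r b) (fun r => b2 (r, b)) a a') hf.abs_d2_sub_le hs1

lemma abs_sub_le_dt_of_coordinatewise {B : ℝ} {F : ℝ × ℝ → ℝ} (hα0 : 0 < α) (hB : 0 ≤ B)
    (h1 : ∀ a a' b, |F (a, b) - F (a', b)| ≤ B * |a - a'| ^ α)
    (h2 : ∀ a b b', |F (a, b) - F (a, b')| ≤ B * |b - b'| ^ (α / 2)) (p q : ℝ × ℝ) :
    |F p - F q| ≤ 2 * B * dt p q ^ α := by
  have e1 := (h1 p.1 q.1 p.2).trans (mul_le_mul_of_nonneg_left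
    (Real.rpow_le_rpow (abs_nonneg _) (abs_fst_sub_le_dt p q) hα0.le) hB)
  have e2 := (h2 q.1 p.2 q.2).trans (mul_le_mul_of_nonneg_left
    (abs_snd_sub_rpow_half_le hα0.le p q) hB)
  have e3 := abs_sub_le (F (p.1, p.2)) (F (q.1, p.2)) (F (q.1, q.2))
  change |F p - F q| ≤ _ at e3
  linarith

end

/-- `C^{2,α}` continuity of the boundary singular operator `K` on
functions supported in a fixed homogeneous ball. -/
theorem stmt9 (c : ℝ) (hc : 0 < c) (α : ℝ) (hα0 : 0 < α) (hα1 : α < 1)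
    (R : ℝ) (hR : 0 < R) :
    ∃ C > (0 : ℝ), ∀ f : ℝ × ℝ → ℝ,
      C2aClass α f → Function.support f ⊆ bhat R 0 →
        C2aClass α (Kop c f) ∧ c2aNorm α (Kop c f) ≤ C * c2aNorm α f := by
  obtain ⟨C, hC0, hC⟩ := exists_Kop_bound (c := c) hc hα0 hα1 (R + R ^ 2)
  refine ⟨64 * C + 1, by positivity, fun f hf hsupp => ?_⟩
  have hα2 : 0 < α / 2 := by positivity
  have hN : 0 ≤ c2aNorm α f := c2aNorm_nonneg
  obtain ⟨g0, g1, g2, g3⟩ := hf.isHolderSupp hα0 hα1 fun p hp => box_of_mem_bhat (hsupp hp)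
  have D1 := hasDerivAt_Kop_fst hc hα0 hα1 g0 g1 hf.hasDerivAt_fst
  have D2 := hasDerivAt_Kop_fst hc hα0 hα1 g1 g2 hf.hasDerivAt_d2_fst
  have D3 := hasDerivAt_Kop_snd hc hα0 hα1 g0 g3 hf.hasDerivAt_snd
  have E1 : d2 (Kop c f) = Kop c (d2 f) := funext fun p => (D1 p.1 p.2).deriv
  have E2 : d2 (Kop c (d2 f)) = Kop c (d2 (d2 f)) := funext fun p => (D2 p.1 p.2).deriv
  have E3 : d3 (Kop c f) = Kop c (d3 f) := funext fun p => (D3 p.1 p.2).deriv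
  obtain ⟨s0, -, -⟩ := hC _ _ g0
  obtain ⟨s1, u1, w1⟩ := hC _ _ g1
  obtain ⟨s2, u2, w2⟩ := hC _ _ g2
  obtain ⟨s3, u3, w3⟩ := hC _ _ g3
  have hB : 0 ≤ C * (8 * c2aNorm α f) := by positivity
  have H2 := abs_sub_le_dt_of_coordinatewise hα0 hB u2 w2
  have H3 := abs_sub_le_dt_of_coordinatewise hα0 hB u3 w3
  refine ⟨?_, ?_⟩
  · unfold C2aClass
    rw [E1, E2, E3]
    exact ⟨⟨_, s0⟩, fun p => (D1 p.1 p.2).differentiableAt, fun p => (D2 p.1 p.2).differentiableAt,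
      fun p => (D3 p.1 p.2).differentiableAt,
      continuous_of_separately_holder hα0 hα2 u1 w1, continuous_of_separately_holder hα0 hα2 u2 w2,
      continuous_of_separately_holder hα0 hα2 u3 w3, ⟨_, s1⟩, ⟨_, s2⟩, ⟨_, s3⟩,
      ⟨_, H2⟩, ⟨_, H3⟩⟩
  · have n0 := supAbs_le s0
    have n1 := supAbs_le s1
    have n2 := supAbs_le s2
    have n3 := supAbs_le s3
    have n4 := holderSemi_le (by positivity) H2
    have n5 := holderSemi_le (by positivity) H3
    unfold c2aNorm at n0 n1 n2 n3 n4 n5 hN ⊢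
    rw [E1, E2, E3]
    linarith
end
end

section
/- Let g:ℝ²→ℝ be compactly supported and Lipschitz with respect to d̃, and for x∈ℝ³ with x₁≠0 set K̃₁(g)(x)=∫_{ℝ²} k̃₁(x,ŷ) g(ŷ) dŷ, where k̃₁(x,ŷ)=2c(x₁²+(x₂−y₂)²)x₁·((x₁²+(x₂−y₂)²)²+16(x₃−y₃)²)^{−3/2}. Then for every x̂₀∈ℝ², K̃₁(g)(x) → (1/2)g(x̂₀) as x → (0,x̂₀) within {x₁>0}, and K̃₁(g)(x) → −(1/2)g(x̂₀) as x → (0,x̂₀) within {x₁<0}. -/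
open MeasureTheory Filter

noncomputable section

/-- The candidate fundamental solution `Γ_c(x, y)` on the first Heisenberg group. -/
def Gam (c : ℝ) (x y : ℝ × ℝ × ℝ) : ℝ :=
  c * (((x.1 - y.1) ^ 2 + (x.2.1 - y.2.1) ^ 2) ^ 2 +
    16 * (x.2.2 - y.2.2 - (1 / 2) * (y.1 * x.2.1 - y.2.1 * x.1)) ^ 2) ^ (-(1 : ℝ) / 2)

/-- Derivative along the left-invariant vector field `X₁ = ∂₁ - (x₂/2) ∂₃`. -/
def X1d (f : ℝ × ℝ × ℝ → ℝ) (x : ℝ × ℝ × ℝ) : ℝ :=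
  fderiv ℝ f x ((1 : ℝ), (0 : ℝ), -(x.2.1 / 2))

/-- Derivative along the left-invariant vector field `X₂ = ∂₂ + (x₁/2) ∂₃`. -/
def X2d (f : ℝ × ℝ × ℝ → ℝ) (x : ℝ × ℝ × ℝ) : ℝ :=
  fderiv ℝ f x ((0 : ℝ), (1 : ℝ), x.1 / 2)

/-- The sub-Laplacian `Δ_ℍ = X₁² + X₂²`. -/
def subLap (f : ℝ × ℝ × ℝ → ℝ) (x : ℝ × ℝ × ℝ) : ℝ :=
  X1d (X1d f) x + X2d (X2d f) x

/-- `c` is the normalizing constant making `Γ_c` the fundamental solution of `Δ_ℍ`. -/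
def IsNormalizing (c : ℝ) : Prop :=
  ∀ φ : ℝ × ℝ × ℝ → ℝ, ContDiff ℝ (⊤ : ℕ∞) φ → HasCompactSupport φ →
    ∫ y, Gam c 0 y * subLap φ y = -φ 0

/-- The reflection-symmetric approximate kernel `k̃₁` (mixed term removed). -/
def ktilde1 (c : ℝ) (x : ℝ × ℝ × ℝ) (y : ℝ × ℝ) : ℝ :=
  2 * c * (x.1 ^ 2 + (x.2.1 - y.1) ^ 2) * x.1 *
    ((x.1 ^ 2 + (x.2.1 - y.1) ^ 2) ^ 2 + 16 * (x.2.2 - y.2) ^ 2) ^ (-(3 : ℝ) / 2)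

open Real

/-- Integral of a radial function over the plane, in terms of the squared radius. -/
lemma integral_radial_sq (q : ℝ → ℝ) :
    ∫ p : ℝ × ℝ, q (p.1 ^ 2 + p.2 ^ 2) = π * ∫ v in Set.Ioi (0 : ℝ), q v := by
  have hr : ∫ r in Set.Ioi (0 : ℝ), r * q (r ^ 2) = (1 / 2) * ∫ v in Set.Ioi (0 : ℝ), q v := by
    rw [← integral_comp_rpow_Ioi_of_pos (g := q) (two_pos : (0 : ℝ) < 2), ← integral_const_mul]
    refine setIntegral_congr_fun measurableSet_Ioi fun r _ => ?_
    have h21 : (2 : ℝ) - 1 = 1 := by norm_num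
    simp [h21]
    ring
  rw [← integral_comp_polarCoord_symm, polarCoord_target,
    setIntegral_congr_fun (g := fun p : ℝ × ℝ => (p.1 * q (p.1 ^ 2)) * (fun _ => 1) p.2)
      (measurableSet_Ioi.prod measurableSet_Ioo)]
  · rw [Measure.volume_eq_prod,
      setIntegral_prod_mul (fun r => r * q (r ^ 2)) (fun _ : ℝ => (1 : ℝ)), hr]
    simp [pi_pos.le]
    ring
  · intro p _
    have : (p.1 * cos p.2) ^ 2 + (p.1 * sin p.2) ^ 2 = p.1 ^ 2 := by
      linear_combination p.1 ^ 2 * sin_sq_add_cos_sq p.2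
    simp [polarCoord_symm_apply, this]

/-- Affine dilation of an integral over the plane. -/
lemma integral_comp_add_mul_prod (f : ℝ × ℝ → ℝ) (p : ℝ × ℝ) {a b : ℝ} (ha : 0 < a) (hb : 0 < b) :
    ∫ y : ℝ × ℝ, f (p.1 + a * y.1, p.2 + b * y.2) = (a * b)⁻¹ * ∫ y, f y := by
  have hmap : Measure.map (Prod.map (fun t : ℝ => a * t) (fun t : ℝ => b * t)) volume =
      ENNReal.ofReal (a * b)⁻¹ • (volume : Measure (ℝ × ℝ)) := by
    rw [Measure.volume_eq_prod, ← Measure.map_prod_map _ _ (measurable_const_mul a)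
      (measurable_const_mul b), map_volume_mul_left ha.ne', map_volume_mul_left hb.ne',
      Measure.prod_smul_left, Measure.prod_smul_right, smul_smul, ← ENNReal.ofReal_mul (abs_nonneg _),
      abs_of_pos (inv_pos.2 ha), abs_of_pos (inv_pos.2 hb), mul_inv]
  have hemb := ((Homeomorph.mulLeft₀ a ha.ne').prodCongr
    (Homeomorph.mulLeft₀ b hb.ne')).measurableEmbedding
  have h := hemb.integral_map (μ := volume) (fun y : ℝ × ℝ => f (p + y))
  have hcoe : ⇑((Homeomorph.mulLeft₀ a ha.ne').prodCongr (Homeomorph.mulLeft₀ b hb.ne')) =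
      Prod.map (fun t : ℝ => a * t) (fun t : ℝ => b * t) := rfl
  rw [hcoe, hmap, integral_smul_measure, integral_add_left_eq_self,
    ENNReal.toReal_ofReal (by positivity)] at h
  rw [← smul_eq_mul, h]
  rfl

lemma integral_paraboloid_swap {Ψ : ℝ → ℝ} (hΨ : Continuous Ψ) {R : ℝ}
    (h0 : ∀ s, R ≤ s → Ψ s = 0) :
    ∫ u : ℝ, ∫ s in Set.Ioi (u ^ 2), Ψ s = 2 * ∫ s, √s * Ψ s := by
  set S : Set (ℝ × ℝ) := {p | p.1 ^ 2 < p.2} with hS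
  have hSm : MeasurableSet S := measurableSet_lt (by fun_prop) (by fun_prop)
  set f : ℝ → ℝ → ℝ := fun u s => S.indicator (fun p => Ψ p.2) (u, s) with hf
  have hfi : Integrable (Function.uncurry f) (volume.prod volume) := by
    set B : Set (ℝ × ℝ) := Set.Icc (-(R + 1)) (R + 1) ×ˢ Set.Icc 0 R with hB
    have heq : Function.uncurry f = (S ∩ B).indicator (fun p => Ψ p.2) := by
      ext ⟨u, s⟩
      by_cases h1 : (u, s) ∈ S
      · by_cases h2 : (u, s) ∈ B
        · simp [f, Function.uncurry, h1, h2]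
        · simp only [Function.uncurry, f, Set.indicator_of_mem h1,
            Set.indicator_of_notMem (fun h => h2 h.2 : (u, s) ∉ S ∩ B)]
          apply h0
          by_contra! hs
          have h1' : u ^ 2 < s := h1
          refine h2 ⟨⟨?_, ?_⟩, ?_, hs.le⟩ <;> simp only <;> nlinarith [sq_nonneg u]
      · simp [f, Function.uncurry, h1]
    rw [heq, integrable_indicator_iff (hSm.inter (measurableSet_Icc.prod measurableSet_Icc))]
    exact ((hΨ.comp continuous_snd).continuousOn.integrableOn_compact
      (isCompact_Icc.prod isCompact_Icc)).mono_set Set.inter_subset_right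
  have hswap := integral_integral_swap hfi
  have hl : ∀ u : ℝ, ∫ s, f u s = ∫ s in Set.Ioi (u ^ 2), Ψ s := fun u => by
    rw [← integral_indicator measurableSet_Ioi]
    rfl
  have hr : ∀ s : ℝ, ∫ u, f u s = 2 * (√s * Ψ s) := fun s => by
    have : (fun u => f u s) = (Set.Ioo (-√s) (√s)).indicator (fun _ => Ψ s) := by
      ext u
      simp only [f, Set.indicator, hS, Set.mem_ofPred_eq, Set.mem_Ioo, Real.sq_lt]
    rw [this, integral_indicator measurableSet_Ioo]
    simp
    ring
  simp only [hl, hr] at hswap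
  rw [hswap, integral_const_mul]

/-- The fourth power of the Korányi gauge. -/
def koranyi (y : ℝ × ℝ × ℝ) : ℝ := (y.1 ^ 2 + y.2.1 ^ 2) ^ 2 + 16 * y.2.2 ^ 2

lemma koranyi_eq_zero_off_compact {h : ℝ → ℝ} {R : ℝ} (h0 : ∀ s, R ≤ s → h s = 0) {y : ℝ × ℝ × ℝ}
    (hy : y ∉ Set.Icc (-(R + 1)) (R + 1) ×ˢ Set.Icc (-(R + 1)) (R + 1) ×ˢ
      Set.Icc (-(R + 1)) (R + 1)) : h (koranyi y) = 0 := by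
  apply h0
  by_contra! hlt
  obtain ⟨a, b, t⟩ := y
  simp only [koranyi] at hlt
  have key : ∀ z : ℝ, z ^ 2 ≤ R + 1 → z ∈ Set.Icc (-(R + 1)) (R + 1) := fun z hz => by
    constructor <;> nlinarith [sq_nonneg (z - 1), sq_nonneg (z + 1), sq_nonneg z]
  have h1 : a ^ 2 + b ^ 2 ≤ R + 1 := by
    nlinarith [sq_nonneg (a ^ 2 + b ^ 2 - 1), sq_nonneg t]
  exact hy ⟨key a (by nlinarith [sq_nonneg b]), key b (by nlinarith [sq_nonneg a]),
    key t (by nlinarith [sq_nonneg (a ^ 2 + b ^ 2), sq_nonneg t])⟩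

lemma continuous_koranyi : Continuous koranyi := by
  unfold koranyi
  fun_prop

lemma setIntegral_Ioi_comp_add_right (Ψ : ℝ → ℝ) (b : ℝ) :
    ∫ w in Set.Ioi (0 : ℝ), Ψ (w + b) = ∫ s in Set.Ioi b, Ψ s := by
  rw [← integral_indicator measurableSet_Ioi, ← integral_indicator measurableSet_Ioi,
    ← integral_add_right_eq_self (Set.indicator (Set.Ioi b) Ψ) b]
  simp [Set.indicator]

lemma integral_sq_mul_koranyi {Ψ : ℝ → ℝ} (hΨ : Continuous Ψ) {R : ℝ}
    (h0 : ∀ s, R ≤ s → Ψ s = 0) :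
    ∫ y : ℝ × ℝ × ℝ, (y.1 ^ 2 + y.2.1 ^ 2) * Ψ (koranyi y) = π / 4 * ∫ s, √s * Ψ s := by
  have hcont : Continuous fun y : ℝ × ℝ × ℝ => (y.1 ^ 2 + y.2.1 ^ 2) * Ψ (koranyi y) := by
    have := continuous_koranyi
    fun_prop
  have hfi : Integrable fun y : ℝ × ℝ × ℝ => (y.1 ^ 2 + y.2.1 ^ 2) * Ψ (koranyi y) := by
    exact hcont.integrable_of_hasCompactSupport (HasCompactSupport.intro
      (isCompact_Icc.prod (isCompact_Icc.prod isCompact_Icc)) fun y hy => by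
        rw [koranyi_eq_zero_off_compact h0 hy, mul_zero])
  have hmp := volume_preserving_prodAssoc (α₁ := ℝ) (β₁ := ℝ) (γ₁ := ℝ)
  rw [← hmp.integral_comp']
  have hfi' := (hmp.integrable_comp_emb MeasurableEquiv.prodAssoc.measurableEmbedding).2 hfi
  rw [Measure.volume_eq_prod] at hfi' ⊢
  refine (integral_prod_symm _ hfi').trans ?_
  have hin : ∀ t : ℝ, (∫ p : ℝ × ℝ, (p.1 ^ 2 + p.2 ^ 2) * Ψ ((p.1 ^ 2 + p.2 ^ 2) ^ 2 + 16 * t ^ 2)) =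
      π / 2 * ∫ s in Set.Ioi ((4 * t) ^ 2), Ψ s := fun t => by
    rw [integral_radial_sq (fun v => v * Ψ (v ^ 2 + 16 * t ^ 2))]
    have h1 : ∫ v in Set.Ioi (0 : ℝ), v * Ψ (v ^ 2 + 16 * t ^ 2) =
        1 / 2 * ∫ w in Set.Ioi (0 : ℝ), Ψ (w + 16 * t ^ 2) := by
      rw [← integral_comp_rpow_Ioi_of_pos (g := fun w => Ψ (w + 16 * t ^ 2))
        (two_pos : (0 : ℝ) < 2), ← integral_const_mul]
      refine setIntegral_congr_fun measurableSet_Ioi fun r _ => ?_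
      have h21 : (2 : ℝ) - 1 = 1 := by norm_num
      simp [h21]
      ring
    rw [h1, setIntegral_Ioi_comp_add_right]
    ring_nf
  change ∫ t : ℝ, ∫ p : ℝ × ℝ, (p.1 ^ 2 + p.2 ^ 2) * Ψ ((p.1 ^ 2 + p.2 ^ 2) ^ 2 + 16 * t ^ 2) = _
  simp only [hin]
  rw [integral_const_mul, Measure.integral_comp_mul_left (fun u => ∫ s in Set.Ioi (u ^ 2), Ψ s),
    integral_paraboloid_swap hΨ h0, abs_of_pos (by norm_num), smul_eq_mul]
  ring

lemma integrable_profile_slice {A : ℝ} (hA : 1 ≤ A) :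
    Integrable fun t : ℝ => (A ^ 2 + 16 * t ^ 2) ^ (-(3 : ℝ) / 2) := by
  have hpos : ∀ t : ℝ, 0 < A ^ 2 + 16 * t ^ 2 := fun t => by positivity
  refine integrable_inv_one_add_sq.mono' ?_ (ae_of_all _ fun t => ?_)
  · exact (Continuous.rpow_const (by fun_prop) fun t => Or.inl (hpos t).ne').aestronglyMeasurable
  · have h1 : 1 + t ^ 2 ≤ A ^ 2 + 16 * t ^ 2 := by nlinarith [sq_nonneg t]
    rw [norm_of_nonneg (rpow_nonneg (hpos t).le _), ← rpow_neg_one]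
    exact (rpow_le_rpow_of_nonpos (by positivity) h1 (by norm_num)).trans
      (rpow_le_rpow_of_exponent_le (by nlinarith [sq_nonneg t]) (by norm_num))

lemma integral_profile_slice {A : ℝ} (hA : 1 ≤ A) :
    ∫ t : ℝ, (A ^ 2 + 16 * t ^ 2) ^ (-(3 : ℝ) / 2) = 1 / (2 * A ^ 2) := by
  have hpos : ∀ t : ℝ, 0 < A ^ 2 + 16 * t ^ 2 := fun t => by positivity
  set G : ℝ → ℝ := fun t => 1 / A ^ 2 * (t * (A ^ 2 + 16 * t ^ 2) ^ (-(1 : ℝ) / 2)) with hG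
  have hderiv : ∀ t, HasDerivAt G ((A ^ 2 + 16 * t ^ 2) ^ (-(3 : ℝ) / 2)) t := fun t => by
    have hb : HasDerivAt (fun t : ℝ => A ^ 2 + 16 * t ^ 2) (32 * t) t := by
      refine (((hasDerivAt_pow 2 t).const_mul 16).const_add (A ^ 2)).congr_deriv ?_
      push_cast; ring
    refine (((hasDerivAt_id t).mul (hb.rpow_const (p := -(1 : ℝ) / 2)
      (Or.inl (hpos t).ne'))).const_mul (1 / A ^ 2)).congr_deriv ?_
    have e1 : -(1 : ℝ) / 2 - 1 = -(3 : ℝ) / 2 := by norm_num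
    have e2 : (A ^ 2 + 16 * t ^ 2) ^ (-(1 : ℝ) / 2) =
        (A ^ 2 + 16 * t ^ 2) * (A ^ 2 + 16 * t ^ 2) ^ (-(3 : ℝ) / 2) := by
      rw [← rpow_one_add' (hpos t).le (by norm_num)]
      norm_num
    rw [e1, e2]
    have : A ≠ 0 := by positivity
    simp only [id]
    field_simp
    ring
  have htop : Tendsto G atTop (nhds (1 / (4 * A ^ 2))) := by
    have h1 : Tendsto (fun t : ℝ => 1 / A ^ 2 * (A ^ 2 * (t ^ 2)⁻¹ + 16) ^ (-(1 : ℝ) / 2)) atTop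
        (nhds (1 / A ^ 2 * (A ^ 2 * 0 + 16) ^ (-(1 : ℝ) / 2))) := by
      refine (Tendsto.rpow_const ?_ (Or.inl (by norm_num))).const_mul _
      exact ((tendsto_inv_atTop_zero.comp (tendsto_pow_atTop two_ne_zero)).const_mul _).add_const _
    have h16 : (16 : ℝ) ^ (-(1 : ℝ) / 2) = 1 / 4 := by
      rw [show (16 : ℝ) = 4 ^ (2 : ℝ) by norm_num, ← rpow_mul (by norm_num)]
      norm_num [rpow_neg_one]
    rw [mul_zero, zero_add, h16] at h1
    convert h1.congr' ?_ using 2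
    · field_simp
    filter_upwards [eventually_gt_atTop 0] with t ht
    have e : A ^ 2 + 16 * t ^ 2 = t ^ (2 : ℝ) * (A ^ 2 * (t ^ 2)⁻¹ + 16) := by
      rw [rpow_two]
      field_simp
    change _ = 1 / A ^ 2 * (t * (A ^ 2 + 16 * t ^ 2) ^ (-(1 : ℝ) / 2))
    rw [e, mul_rpow (by positivity) (by positivity), ← rpow_mul ht.le, ← mul_assoc t]
    norm_num [rpow_neg_one, ht.ne']
  have hbot : Tendsto G atBot (nhds (-(1 / (4 * A ^ 2)))) := by
    have := (htop.comp tendsto_neg_atBot_atTop).neg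
    refine this.congr fun t => ?_
    simp [hG]
  rw [integral_of_hasDerivAt_of_tendsto hderiv (integrable_profile_slice hA) hbot htop]
  have : A ≠ 0 := by positivity
  field_simp
  norm_num

lemma ktilde1_one_zero (c : ℝ) (y : ℝ × ℝ) : ktilde1 c (1, 0, 0) y =
    2 * c * (1 + y.1 ^ 2) * ((1 + y.1 ^ 2) ^ 2 + 16 * y.2 ^ 2) ^ (-(3 : ℝ) / 2) := by
  simp [ktilde1]

lemma continuous_ktilde1_one_zero (c : ℝ) : Continuous (ktilde1 c (1, 0, 0)) := by
  simp only [funext (ktilde1_one_zero c)]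
  exact Continuous.mul (by fun_prop) (Continuous.rpow_const (by fun_prop)
    fun y => Or.inl (by positivity))

lemma integral_ktilde1_slice (c s : ℝ) :
    ∫ t : ℝ, ktilde1 c (1, 0, 0) (s, t) = c * (1 + s ^ 2)⁻¹ := by
  simp only [ktilde1_one_zero]
  rw [integral_const_mul, integral_profile_slice (by nlinarith [sq_nonneg s])]
  field_simp

lemma integrable_ktilde1_one_zero {c : ℝ} (hc : 0 < c) :
    Integrable (ktilde1 c (1, 0, 0)) := by
  rw [Measure.volume_eq_prod,
    integrable_prod_iff (continuous_ktilde1_one_zero c).aestronglyMeasurable]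
  refine ⟨ae_of_all _ fun s => ?_, ?_⟩
  · simp only [ktilde1_one_zero]
    exact (integrable_profile_slice (by nlinarith [sq_nonneg s])).const_mul _
  · have : ∀ y, ‖ktilde1 c (1, 0, 0) y‖ = ktilde1 c (1, 0, 0) y := fun y => by
      rw [ktilde1_one_zero]
      exact norm_of_nonneg (by positivity)
    simp only [this, integral_ktilde1_slice]
    exact integrable_inv_one_add_sq.const_mul c

lemma integral_ktilde1_one_zero {c : ℝ} (hc : 0 < c) :
    ∫ y, ktilde1 c (1, 0, 0) y = c * π := by
  rw [Measure.volume_eq_prod, integral_prod _ (integrable_ktilde1_one_zero hc)]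
  simp only [integral_ktilde1_slice]
  rw [integral_const_mul, integral_univ_inv_one_add_sq]

/-- Homogeneity of the kernel under the parabolic dilations of the plane. -/
lemma ktilde1_dilation (c : ℝ) {a : ℝ} (ha : 0 < a) (p y : ℝ × ℝ) :
    ktilde1 c (a, p.1, p.2) (p.1 + a * y.1, p.2 + a ^ 2 * y.2) =
      (a * a ^ 2)⁻¹ * ktilde1 c (1, 0, 0) y := by
  rw [ktilde1_one_zero]
  simp only [ktilde1]
  have e : (a ^ 2 + (p.1 - (p.1 + a * y.1)) ^ 2) ^ 2 + 16 * (p.2 - (p.2 + a ^ 2 * y.2)) ^ 2 =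
      a ^ (4 : ℝ) * ((1 + y.1 ^ 2) ^ 2 + 16 * y.2 ^ 2) := by
    norm_cast
    ring
  have e6 : a ^ ((4 : ℝ) * (-3 / 2)) = (a ^ 6)⁻¹ := by
    rw [show (4 : ℝ) * (-3 / 2) = -(6 : ℕ) by norm_num, rpow_neg ha.le, rpow_natCast]
  rw [e, mul_rpow (by positivity) (by positivity), ← rpow_mul ha.le, e6]
  field_simp
  ring

lemma integral_ktilde1_mul (c : ℝ) (g : ℝ × ℝ → ℝ) {a : ℝ} (ha : 0 < a) (p : ℝ × ℝ) :
    ∫ y, ktilde1 c (a, p.1, p.2) y * g y =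
      ∫ y : ℝ × ℝ, ktilde1 c (1, 0, 0) y * g (p.1 + a * y.1, p.2 + a ^ 2 * y.2) := by
  have h := integral_comp_add_mul_prod (fun y => ktilde1 c (a, p.1, p.2) y * g y) p ha
    (pow_pos ha 2)
  simp only [ktilde1_dilation c ha, mul_assoc] at h
  rw [integral_const_mul] at h
  exact (mul_left_cancel₀ (by positivity) h).symm

lemma ktilde1_neg (c : ℝ) (a : ℝ) (p y : ℝ × ℝ) :
    ktilde1 c (-a, p.1, p.2) y = -ktilde1 c (a, p.1, p.2) y := by
  simp [ktilde1]

lemma continuous_of_dt_lipschitz {g : ℝ × ℝ → ℝ} {L : ℝ}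
    (hLip : ∀ a b : ℝ × ℝ, |g a - g b| ≤ L * dt a b) : Continuous g := by
  refine continuous_iff_continuousAt.2 fun b => tendsto_iff_dist_tendsto_zero.2 ?_
  have hdt : Continuous fun a => L * dt a b := by
    unfold dt
    exact continuous_const.mul (Continuous.rpow_const (by fun_prop) fun _ => Or.inr (by norm_num))
  have h0 : L * dt b b = 0 := by simp [dt]
  exact squeeze_zero (fun _ => dist_nonneg) (fun a => hLip a b) (h0 ▸ hdt.tendsto b)

/-- Jump from the positive side, up to the total mass of the kernel. -/
lemma tendsto_integral_ktilde1_pos {c : ℝ} (hc : 0 < c) {g : ℝ × ℝ → ℝ} (hg : HasCompactSupport g)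
    (hgc : Continuous g) (x0 : ℝ × ℝ) :
    Tendsto (fun x : ℝ × ℝ × ℝ => ∫ y, ktilde1 c x y * g y)
      (nhdsWithin ((0 : ℝ), x0.1, x0.2) {x : ℝ × ℝ × ℝ | 0 < x.1}) (nhds (c * π * g x0)) := by
  obtain ⟨M, hM⟩ := hg.exists_bound_of_continuous hgc
  have hlim : Tendsto (fun x : ℝ × ℝ × ℝ => ∫ y : ℝ × ℝ, ktilde1 c (1, 0, 0) y *
      g (x.2.1 + x.1 * y.1, x.2.2 + x.1 ^ 2 * y.2))
      (nhdsWithin ((0 : ℝ), x0.1, x0.2) {x : ℝ × ℝ × ℝ | 0 < x.1})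
      (nhds (∫ y, ktilde1 c (1, 0, 0) y * g x0)) := by
    refine tendsto_integral_filter_of_dominated_convergence
      (fun y => ‖ktilde1 c (1, 0, 0) y‖ * M) (Eventually.of_forall fun x => ?_)
      (Eventually.of_forall fun x => ae_of_all _ fun y => ?_)
      ((integrable_ktilde1_one_zero hc).norm.mul_const M) (ae_of_all _ fun y => ?_)
    · exact ((continuous_ktilde1_one_zero c).mul (by fun_prop)).aestronglyMeasurable
    · rw [norm_mul]
      exact mul_le_mul_of_nonneg_left (hM _) (norm_nonneg _)
    · have hcont : Continuous fun x : ℝ × ℝ × ℝ => ktilde1 c (1, 0, 0) y *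
          g (x.2.1 + x.1 * y.1, x.2.2 + x.1 ^ 2 * y.2) := by fun_prop
      have := hcont.tendsto ((0 : ℝ), x0.1, x0.2)
      simp only [zero_mul, add_zero, ne_eq, OfNat.ofNat_ne_zero, not_false_eq_true, zero_pow,
        Prod.mk.eta] at this
      exact this.mono_left nhdsWithin_le_nhds
  rw [integral_mul_const, integral_ktilde1_one_zero hc] at hlim
  refine hlim.congr' ?_
  filter_upwards [self_mem_nhdsWithin] with x hx
  exact (integral_ktilde1_mul c g hx x.2).symm

lemma tendsto_integral_ktilde1_neg {c : ℝ} (hc : 0 < c) {g : ℝ × ℝ → ℝ} (hg : HasCompactSupport g)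
    (hgc : Continuous g) (x0 : ℝ × ℝ) :
    Tendsto (fun x : ℝ × ℝ × ℝ => ∫ y, ktilde1 c x y * g y)
      (nhdsWithin ((0 : ℝ), x0.1, x0.2) {x : ℝ × ℝ × ℝ | x.1 < 0}) (nhds (-(c * π * g x0))) := by
  have hrefl : Tendsto (fun x : ℝ × ℝ × ℝ => (-x.1, x.2))
      (nhdsWithin ((0 : ℝ), x0.1, x0.2) {x : ℝ × ℝ × ℝ | x.1 < 0})
      (nhdsWithin ((0 : ℝ), x0.1, x0.2) {x : ℝ × ℝ × ℝ | 0 < x.1}) := by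
    refine tendsto_nhdsWithin_iff.2 ⟨?_, ?_⟩
    · have hcont : Continuous fun x : ℝ × ℝ × ℝ => (-x.1, x.2) := by fun_prop
      have := hcont.tendsto ((0 : ℝ), x0.1, x0.2)
      simp only [neg_zero] at this
      exact this.mono_left nhdsWithin_le_nhds
    · filter_upwards [self_mem_nhdsWithin] with x hx
      simpa using hx
  refine ((tendsto_integral_ktilde1_pos hc hg hgc x0).comp hrefl).neg.congr fun x => ?_
  have : ∀ y, ktilde1 c (-x.1, x.2) y = -ktilde1 c x y := ktilde1_neg c x.1 x.2
  simp [this, integral_neg]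

/-- Derivative of `f` along `v` computed on the line through `x`. -/
lemma fderiv_apply_eq_of_line {f : ℝ × ℝ × ℝ → ℝ} (hf : Differentiable ℝ f) {x v : ℝ × ℝ × ℝ}
    {d : ℝ} (h : HasDerivAt (fun t : ℝ => f (x + t • v)) d 0) : fderiv ℝ f x v = d := by
  rw [← (hf x).lineDeriv_eq_fderiv]
  exact HasLineDerivAt.lineDeriv h

lemma contDiff_koranyi : ContDiff ℝ (⊤ : ℕ∞) koranyi := by
  unfold koranyi
  fun_prop

lemma hasDerivAt_koranyi_line (x v : ℝ × ℝ × ℝ) :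
    HasDerivAt (fun t : ℝ => koranyi (x + t • v))
      (4 * (x.1 ^ 2 + x.2.1 ^ 2) * (x.1 * v.1 + x.2.1 * v.2.1) + 32 * x.2.2 * v.2.2) 0 := by
  have hl : ∀ a b : ℝ, HasDerivAt (fun t : ℝ => a + t * b) b 0 := fun a b => by
    simpa using ((hasDerivAt_id (0 : ℝ)).mul_const b).const_add a
  refine (((((hl x.1 v.1).pow 2).add ((hl x.2.1 v.2.1).pow 2)).pow 2).add
    (((hl x.2.2 v.2.2).pow 2).const_mul 16)).congr_deriv ?_
  simp
  ring

lemma X1d_comp_koranyi {h : ℝ → ℝ} (hh : Differentiable ℝ h) :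
    X1d (fun y => h (koranyi y)) = fun x =>
      deriv h (koranyi x) * (4 * (x.1 ^ 2 + x.2.1 ^ 2) * x.1 - 16 * x.2.1 * x.2.2) := by
  ext x
  refine fderiv_apply_eq_of_line
    (hh.comp (contDiff_koranyi.differentiable (by simp))) ?_
  refine ((hh _).hasDerivAt.comp (0 : ℝ) (hasDerivAt_koranyi_line x _)).congr_deriv ?_
  simp
  left
  ring

lemma X2d_comp_koranyi {h : ℝ → ℝ} (hh : Differentiable ℝ h) :
    X2d (fun y => h (koranyi y)) = fun x =>
      deriv h (koranyi x) * (4 * (x.1 ^ 2 + x.2.1 ^ 2) * x.2.1 + 16 * x.1 * x.2.2) := by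
  ext x
  refine fderiv_apply_eq_of_line
    (hh.comp (contDiff_koranyi.differentiable (by simp))) ?_
  refine ((hh _).hasDerivAt.comp (0 : ℝ) (hasDerivAt_koranyi_line x _)).congr_deriv ?_
  simp
  left
  ring

/-- The sub-Laplacian of a function of the Korányi gauge. -/
lemma subLap_comp_koranyi {h : ℝ → ℝ} (hh : ContDiff ℝ (⊤ : ℕ∞) h) (x : ℝ × ℝ × ℝ) :
    subLap (fun y => h (koranyi y)) x = (x.1 ^ 2 + x.2.1 ^ 2) *
      (16 * koranyi x * deriv (deriv h) (koranyi x) + 24 * deriv h (koranyi x)) := by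
  have hh1 := contDiff_infty_iff_deriv.1 hh
  have hd2 : Differentiable ℝ (deriv h) := hh1.2.differentiable (by simp)
  have hk : Differentiable ℝ fun y : ℝ × ℝ × ℝ => deriv h (koranyi y) :=
    hd2.comp (contDiff_koranyi.differentiable (by simp))
  have hl : ∀ a b : ℝ, HasDerivAt (fun t : ℝ => a + t * b) b 0 := fun a b => by
    simpa using ((hasDerivAt_id (0 : ℝ)).mul_const b).const_add a
  have hz : ((0, 0, 0) : ℝ × ℝ × ℝ) = 0 := rfl
  have h1 : X1d (X1d fun y => h (koranyi y)) x =
      deriv (deriv h) (koranyi x) * (4 * (x.1 ^ 2 + x.2.1 ^ 2) * x.1 - 16 * x.2.1 * x.2.2) ^ 2 +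
        deriv h (koranyi x) * (12 * (x.1 ^ 2 + x.2.1 ^ 2)) := by
    rw [X1d_comp_koranyi hh1.1]
    refine fderiv_apply_eq_of_line (by fun_prop) ?_
    have hq := ((((((hl x.1 1).pow 2).add ((hl x.2.1 0).pow 2)).const_mul 4).mul (hl x.1 1)).sub
      (((hl x.2.1 0).const_mul 16).mul (hl x.2.2 (-(x.2.1 / 2)))))
    refine (((hd2 _).hasDerivAt.comp (0 : ℝ)
      (hasDerivAt_koranyi_line x (1, 0, -(x.2.1 / 2)))).mul hq).congr_deriv ?_
    simp [hz]
    ring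
  have h2 : X2d (X2d fun y => h (koranyi y)) x =
      deriv (deriv h) (koranyi x) * (4 * (x.1 ^ 2 + x.2.1 ^ 2) * x.2.1 + 16 * x.1 * x.2.2) ^ 2 +
        deriv h (koranyi x) * (12 * (x.1 ^ 2 + x.2.1 ^ 2)) := by
    rw [X2d_comp_koranyi hh1.1]
    refine fderiv_apply_eq_of_line (by fun_prop) ?_
    have hq := ((((((hl x.1 0).pow 2).add ((hl x.2.1 1).pow 2)).const_mul 4).mul (hl x.2.1 1)).add
      (((hl x.1 0).const_mul 16).mul (hl x.2.2 (x.1 / 2))))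
    refine (((hd2 _).hasDerivAt.comp (0 : ℝ)
      (hasDerivAt_koranyi_line x (0, 1, x.1 / 2))).mul hq).congr_deriv ?_
    simp [hz]
    ring
  rw [subLap, h1, h2]
  simp only [koranyi]
  ring

lemma deriv_eq_zero_of_eqOn {f : ℝ → ℝ} {U : Set ℝ} (hU : IsOpen U) {k : ℝ}
    (hf : ∀ s ∈ U, f s = k) {s : ℝ} (hs : s ∈ U) : deriv f s = 0 := by
  have : f =ᶠ[nhds s] fun _ => k := by
    filter_upwards [hU.mem_nhds hs] with t ht using hf t ht
  rw [this.deriv_eq, deriv_const]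

/-- The normalizing constant of the fundamental solution is `1 / (2π)`. -/
lemma IsNormalizing.mul_pi {c : ℝ} (hnorm : IsNormalizing c) : c * π = 1 / 2 := by
  set h : ℝ → ℝ := fun s => Real.smoothTransition (2 - s) with hdef
  have hh : ContDiff ℝ (⊤ : ℕ∞) h := smoothTransition.contDiff.comp (by fun_prop)
  have h_one : ∀ s ∈ Set.Iio (1 : ℝ), h s = 1 := fun s hs =>
    smoothTransition.one_of_one_le (by linarith [Set.mem_Iio.1 hs])
  have h_zero : ∀ s, 2 ≤ s → h s = 0 := fun s hs =>
    smoothTransition.zero_of_nonpos (by linarith)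
  have h_zero' : ∀ s ∈ Set.Ioi (2 : ℝ), h s = 0 := fun s hs => h_zero s (le_of_lt hs)
  have hh1 := contDiff_infty_iff_deriv.1 hh
  have hd2 := contDiff_infty_iff_deriv.1 hh1.2
  have hd3 : Continuous (deriv (deriv h)) := hd2.2.continuous
  have hd1c : Continuous (deriv h) := hh1.2.continuous
  have hd_one : ∀ s ∈ Set.Iio (1 : ℝ), deriv h s = 0 := fun s hs =>
    deriv_eq_zero_of_eqOn isOpen_Iio h_one hs
  have hd_zero : ∀ s ∈ Set.Ioi (2 : ℝ), deriv h s = 0 := fun s hs =>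
    deriv_eq_zero_of_eqOn isOpen_Ioi h_zero' hs
  set Φ : ℝ → ℝ := fun s => 16 * s * deriv (deriv h) s + 24 * deriv h s with hΦ
  have hΦ_one : ∀ s ∈ Set.Iio (1 : ℝ), Φ s = 0 := fun s hs => by
    simp [hΦ, hd_one s hs, deriv_eq_zero_of_eqOn isOpen_Iio hd_one hs]
  have hΦ_zero : ∀ s ∈ Set.Ioi (2 : ℝ), Φ s = 0 := fun s hs => by
    simp [hΦ, hd_zero s hs, deriv_eq_zero_of_eqOn isOpen_Ioi hd_zero hs]
  have hΦc : Continuous Φ := by fun_prop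
  set Ψ : ℝ → ℝ := fun s => s ^ (-(1 : ℝ) / 2) * Φ s with hΨ
  have hΨc : Continuous Ψ := by
    refine continuous_iff_continuousAt.2 fun s => ?_
    rcases lt_or_ge s 1 with hs | hs
    · have : Ψ =ᶠ[nhds s] fun _ => 0 := by
        filter_upwards [isOpen_Iio.mem_nhds hs] with t ht
        simp [hΨ, hΦ_one t ht]
      exact continuousAt_const.congr this.symm
    · exact (continuousAt_rpow_const s _ (Or.inl (by linarith))).mul hΦc.continuousAt
  have hΨ_zero : ∀ s, 3 ≤ s → Ψ s = 0 := fun s hs => by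
    simp [hΨ, hΦ_zero s (Set.mem_Ioi.2 (by linarith))]
  have hsqrt : ∀ s, √s * Ψ s = Φ s := fun s => by
    rcases lt_or_ge s 1 with hs | hs
    · simp [hΨ, hΦ_one s hs]
    · have hs0 : (0 : ℝ) < s := by linarith
      simp only [hΨ]
      rw [sqrt_eq_rpow, ← mul_assoc, ← rpow_add hs0]
      norm_num
  have hΦ_int : ∫ s, Φ s = -8 := by
    have hΦi : Integrable Φ := hΦc.integrable_of_hasCompactSupport
      (HasCompactSupport.intro (isCompact_Icc (a := (1 : ℝ)) (b := 2)) fun s hs => by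
        rcases lt_or_ge s 1 with h1 | h1
        · exact hΦ_one s h1
        · exact hΦ_zero s (lt_of_not_ge fun h2 => hs ⟨h1, h2⟩))
    have hder : ∀ s, HasDerivAt (fun s => 16 * s * deriv h s + 8 * h s) (Φ s) s := fun s => by
      refine ((((hasDerivAt_id s).const_mul 16).mul (hd2.1 s).hasDerivAt).add
        ((hh1.1 s).hasDerivAt.const_mul 8)).congr_deriv ?_
      simp [hΦ]
      ring
    rw [integral_of_hasDerivAt_of_tendsto (m := 8) (n := 0) hder hΦi]
    · norm_num
    · refine tendsto_const_nhds.congr' ?_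
      filter_upwards [eventually_lt_atBot 1] with s hs
      simp [h_one s hs, hd_one s hs]
    · refine tendsto_const_nhds.congr' ?_
      filter_upwards [eventually_gt_atTop 2] with s hs
      simp [h_zero' s hs, hd_zero s hs]
  have hφ := hnorm (fun y => h (koranyi y)) (hh.comp contDiff_koranyi)
    (HasCompactSupport.intro (isCompact_Icc.prod (isCompact_Icc.prod isCompact_Icc))
      fun y hy => koranyi_eq_zero_off_compact h_zero hy)
  have hGam : ∀ y, Gam c 0 y * subLap (fun y => h (koranyi y)) y =
      c * ((y.1 ^ 2 + y.2.1 ^ 2) * Ψ (koranyi y)) := fun y => by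
    have hG : Gam c 0 y = c * koranyi y ^ (-(1 : ℝ) / 2) := by
      simp [Gam, koranyi]
    rw [hG, subLap_comp_koranyi hh]
    simp only [hΨ, hΦ]
    ring
  have h0 : h (koranyi 0) = 1 := h_one _ (by simp [koranyi])
  simp only [hGam] at hφ
  rw [integral_const_mul, integral_sq_mul_koranyi hΨc hΨ_zero, h0] at hφ
  simp only [hsqrt, hΦ_int] at hφ
  linarith

/-- Jump relations for the modified operator `K̃₁` with the
reflection-symmetric kernel `k̃₁`. -/
theorem stmt10 (c : ℝ) (hc : 0 < c) (hnorm : IsNormalizing c)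
    (g : ℝ × ℝ → ℝ) (hg : HasCompactSupport g)
    (L : ℝ) (hLip : ∀ a b : ℝ × ℝ, |g a - g b| ≤ L * dt a b)
    (x0 : ℝ × ℝ) :
    Tendsto (fun x : ℝ × ℝ × ℝ => ∫ y, ktilde1 c x y * g y)
      (nhdsWithin ((0 : ℝ), x0.1, x0.2) {x : ℝ × ℝ × ℝ | 0 < x.1})
      (nhds ((1 / 2) * g x0)) ∧
    Tendsto (fun x : ℝ × ℝ × ℝ => ∫ y, ktilde1 c x y * g y)
      (nhdsWithin ((0 : ℝ), x0.1, x0.2) {x : ℝ × ℝ × ℝ | x.1 < 0})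
      (nhds (-(1 / 2) * g x0)) := by
  have hgc := continuous_of_dt_lipschitz hLip
  have hpos := tendsto_integral_ktilde1_pos hc hg hgc x0
  have hneg := tendsto_integral_ktilde1_neg hc hg hgc x0
  rw [hnorm.mul_pi] at hpos hneg
  rw [← neg_mul] at hneg
  exact ⟨hpos, hneg⟩
end
end
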